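/- For all positive integers N and d there is a constant C(N,d) > 0 such that for every polynomial f ∈ ℝ[x₁,…,x_N] of degree at most d and every integer r ≥ 2Nd, the Schmüdgen SOS bound for minimizing f over the standard simplex satisfies f_min − lb(f,T(Δ_N))_r ≤ (C(N,d)/r²)·(f_max − f_min), where f_min and f_max denote the minimum and the maximum value of f attained on Δ_N. -/

import Mathlib

open MvPolynomial

/-- A polynomial is SOS if it is a finite sum of squares of polynomials. -/
def IsSOS {σ : Type*} (p : MvPolynomial σ ℝ) : Prop :=
  ∃ (k : ℕ) (q : Fin k → MvPolynomial σ ℝ), p = ∑ i, q i ^ 2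

/-- The defining polynomials of the standard simplex: `g_i = x_i` for `i ∈ [N]`
and `g_0 = 1 − ∑_i x_i` (encoded as `none`). -/
noncomputable def simplexG (N : ℕ) : Option (Fin N) → MvPolynomial (Fin N) ℝ
  | none => C 1 - ∑ i, X i
  | some i => X i

/-- Membership in the truncated preordering `T(Δ_N)_{2r}` of the standard simplex. -/
def InPreSimplex (N r : ℕ) (f : MvPolynomial (Fin N) ℝ) : Prop :=
  ∃ σI : Finset (Option (Fin N)) → MvPolynomial (Fin N) ℝ,
    (∀ I, IsSOS (σI I) ∧ (σI I * ∏ i ∈ I, simplexG N i).totalDegree ≤ 2 * r) ∧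
    f = ∑ I : Finset (Option (Fin N)), σI I * ∏ i ∈ I, simplexG N i

/-- The Schmüdgen SOS lower bound `lb(f, T(Δ_N))_r` over the standard simplex. -/
noncomputable def lbSimplex (N r : ℕ) (f : MvPolynomial (Fin N) ℝ) : ℝ :=
  sSup {c : ℝ | InPreSimplex N r (f - C c)}

/-- The standard simplex `Δ_N`. -/
def stdSimplexSet (N : ℕ) : Set (Fin N → ℝ) :=
  {x | (∀ i, 0 ≤ x i) ∧ ∑ i, x i ≤ 1}

section SumsOfSquares

variable {σ : Type*}

theorem isSOS_sum_sq {κ : Type*} (s : Finset κ) (q : κ → MvPolynomial σ ℝ) :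
    IsSOS (∑ i ∈ s, q i ^ 2) := by
  refine ⟨s.card, fun i => q (s.equivFin.symm i), ?_⟩
  rw [← Finset.sum_coe_sort s, ← s.equivFin.symm.sum_comp]

theorem isSOS_zero : IsSOS (0 : MvPolynomial σ ℝ) := ⟨0, Fin.elim0, by simp⟩

theorem isSOS_sq (p : MvPolynomial σ ℝ) : IsSOS (p ^ 2) := ⟨1, fun _ => p, by simp⟩

theorem IsSOS.add {p q : MvPolynomial σ ℝ} (hp : IsSOS p) (hq : IsSOS q) : IsSOS (p + q) := by
  obtain ⟨k, u, rfl⟩ := hp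
  obtain ⟨l, v, rfl⟩ := hq
  exact ⟨k + l, Fin.append u v, by simp [Fin.sum_univ_add]⟩

theorem IsSOS.C_mul {p : MvPolynomial σ ℝ} (hp : IsSOS p) {c : ℝ} (hc : 0 ≤ c) :
    IsSOS (C c * p) := by
  obtain ⟨k, u, rfl⟩ := hp
  refine ⟨k, fun i => C (√c) * u i, ?_⟩
  simp_rw [mul_pow, ← map_pow, Real.sq_sqrt hc, Finset.mul_sum]

theorem IsSOS.eval_nonneg {p : MvPolynomial σ ℝ} (hp : IsSOS p) (x : σ → ℝ) : 0 ≤ eval x p := by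
  obtain ⟨k, u, rfl⟩ := hp
  simp only [map_sum, map_pow]
  positivity

end SumsOfSquares

section Preordering

variable {N r : ℕ}

theorem totalDegree_simplexG_le (i : Option (Fin N)) : (simplexG N i).totalDegree ≤ 1 := by
  cases i with
  | none =>
    refine (totalDegree_sub _ _).trans (max_le (by simp) ?_)
    exact totalDegree_finsetSum_le fun i _ => by simp
  | some i => simp [simplexG]

theorem totalDegree_prod_simplexG_pow_le (e : Option (Fin N) → ℕ) :
    (∏ i, simplexG N i ^ e i).totalDegree ≤ ∑ i, e i := by
  refine (totalDegree_finsetProd _ _).trans (Finset.sum_le_sum fun i _ => ?_)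
  exact (totalDegree_pow _ _).trans (by nlinarith [totalDegree_simplexG_le i])

theorem sum_simplexG : ∑ i, simplexG N i = 1 := by
  simp [Fintype.sum_option, simplexG]

theorem eval_simplexG_nonneg {x : Fin N → ℝ} (hx : x ∈ stdSimplexSet N) (i : Option (Fin N)) :
    0 ≤ eval x (simplexG N i) := by
  cases i with
  | none => simpa [simplexG] using hx.2
  | some i => simpa [simplexG] using hx.1 i

theorem InPreSimplex.add {p q : MvPolynomial (Fin N) ℝ} (hp : InPreSimplex N r p)
    (hq : InPreSimplex N r q) : InPreSimplex N r (p + q) := by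
  obtain ⟨u, hu, rfl⟩ := hp
  obtain ⟨v, hv, rfl⟩ := hq
  refine ⟨u + v, fun I => ⟨(hu I).1.add (hv I).1, ?_⟩, ?_⟩
  · rw [Pi.add_apply, add_mul]
    exact (totalDegree_add _ _).trans (max_le (hu I).2 (hv I).2)
  · simp [add_mul, Finset.sum_add_distrib]

theorem InPreSimplex.C_mul {p : MvPolynomial (Fin N) ℝ} (hp : InPreSimplex N r p) {c : ℝ}
    (hc : 0 ≤ c) : InPreSimplex N r (C c * p) := by
  obtain ⟨u, hu, rfl⟩ := hp
  refine ⟨fun I => C c * u I, fun I => ⟨(hu I).1.C_mul hc, ?_⟩, ?_⟩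
  · rw [mul_assoc]
    exact (totalDegree_mul _ _).trans (by simpa using (hu I).2)
  · simp [Finset.mul_sum, mul_assoc]

theorem inPreSimplex_zero : InPreSimplex N r 0 :=
  ⟨fun _ => 0, fun _ => ⟨isSOS_zero, by simp⟩, by simp⟩

theorem InPreSimplex.sum {κ : Type*} {s : Finset κ} {p : κ → MvPolynomial (Fin N) ℝ}
    (hp : ∀ i ∈ s, InPreSimplex N r (p i)) : InPreSimplex N r (∑ i ∈ s, p i) :=
  Finset.sum_induction p (InPreSimplex N r) (fun _ _ => InPreSimplex.add) inPreSimplex_zero hp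

theorem InPreSimplex.eval_nonneg {p : MvPolynomial (Fin N) ℝ} (hp : InPreSimplex N r p)
    {x : Fin N → ℝ} (hx : x ∈ stdSimplexSet N) : 0 ≤ eval x p := by
  obtain ⟨u, hu, rfl⟩ := hp
  simp only [map_sum, map_mul, map_prod]
  exact Finset.sum_nonneg fun I _ => mul_nonneg ((hu I).1.eval_nonneg x)
    (Finset.prod_nonneg fun i _ => eval_simplexG_nonneg hx i)

theorem inPreSimplex_of_isSOS_mul {I : Finset (Option (Fin N))} {s : MvPolynomial (Fin N) ℝ}
    (hs : IsSOS s) (hdeg : (s * ∏ i ∈ I, simplexG N i).totalDegree ≤ 2 * r) :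
    InPreSimplex N r (s * ∏ i ∈ I, simplexG N i) := by
  classical
  refine ⟨fun J => if J = I then s else 0, fun J => ?_, by simp⟩
  by_cases h : J = I
  · subst h; simpa using ⟨hs, hdeg⟩
  · simpa [h] using isSOS_zero

/-- The indices at which an exponent is odd. -/
def oddSupport {ι : Type*} [Fintype ι] (e : ι → ℕ) : Finset ι :=
  Finset.univ.filter fun i => e i % 2 = 1

theorem prod_pow_eq_sq_mul_prod_oddSupport {ι R : Type*} [Fintype ι] [CommMonoid R]
    (g : ι → R) (e : ι → ℕ) :
    ∏ i, g i ^ e i = (∏ i, g i ^ (e i / 2)) ^ 2 * ∏ i ∈ oddSupport e, g i := by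
  rw [oddSupport, Finset.prod_filter, ← Finset.prod_pow, ← Finset.prod_mul_distrib]
  refine Finset.prod_congr rfl fun i _ => ?_
  rcases Nat.mod_two_eq_zero_or_one (e i) with h | h
  · rw [if_neg (by omega), mul_one, ← pow_mul]; congr 1; omega
  · rw [if_pos h, ← pow_mul, ← pow_succ]; congr 1; omega

theorem inPreSimplex_prod_pow {e : Option (Fin N) → ℕ} (he : ∑ i, e i ≤ 2 * r) :
    InPreSimplex N r (∏ i, simplexG N i ^ e i) := by
  have h := prod_pow_eq_sq_mul_prod_oddSupport (simplexG N) e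
  have hd := (totalDegree_prod_simplexG_pow_le e).trans he
  rw [h] at hd ⊢
  exact inPreSimplex_of_isSOS_mul (isSOS_sq _) hd

theorem inPreSimplex_one : InPreSimplex N r 1 := by
  simpa using inPreSimplex_prod_pow (N := N) (r := r) (e := 0) (by simp)

theorem inPreSimplex_C {c : ℝ} (hc : 0 ≤ c) : InPreSimplex N r (C c) := by
  simpa using inPreSimplex_one.C_mul hc

theorem inPreSimplex_one_sub_prod_pow {e : Option (Fin N) → ℕ} (he : ∑ i, e i ≤ 2 * r) :
    InPreSimplex N r (1 - ∏ i, simplexG N i ^ e i) := by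
  classical
  have h1 : (1 : MvPolynomial (Fin N) ℝ) = (∑ i, simplexG N i) ^ (∑ i, e i) := by
    rw [sum_simplexG, one_pow]
  have hmem : e ∈ Finset.univ.piAntidiag (∑ i, e i) := by simp
  rw [h1, Finset.sum_pow_eq_sum_piAntidiag, ← Finset.add_sum_erase _ _ hmem, add_sub_right_comm]
  refine InPreSimplex.add ?_ (InPreSimplex.sum fun k hk => ?_)
  · have hpos : 1 ≤ Nat.multinomial Finset.univ e := Nat.multinomial_pos _ _
    have := (inPreSimplex_prod_pow he).C_mul (c := (Nat.multinomial Finset.univ e : ℝ) - 1)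
      (by simpa using hpos)
    convert this using 1
    simp [sub_mul]
  · have hk' : ∑ i, k i = ∑ i, e i := by simpa using (Finset.mem_erase.1 hk).2
    have := (inPreSimplex_prod_pow (hk'.trans_le he)).C_mul
      (c := (Nat.multinomial Finset.univ k : ℝ)) (by positivity)
    simpa using this

/-- `p` is bounded by `t` in absolute value up to membership in the truncated preordering. -/
def PreBounded (N r : ℕ) (t : ℝ) (p : MvPolynomial (Fin N) ℝ) : Prop :=
  InPreSimplex N r (C t + p) ∧ InPreSimplex N r (C t - p)

theorem preBounded_prod_pow {e : Option (Fin N) → ℕ} (he : ∑ i, e i ≤ 2 * r) :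
    PreBounded N r 1 (∏ i, simplexG N i ^ e i) :=
  ⟨by simpa using inPreSimplex_one.add (inPreSimplex_prod_pow he),
    by simpa using inPreSimplex_one_sub_prod_pow he⟩

theorem preBounded_zero : PreBounded N r 0 0 := by
  simpa [PreBounded] using inPreSimplex_zero

theorem PreBounded.neg {t : ℝ} {p : MvPolynomial (Fin N) ℝ} (h : PreBounded N r t p) :
    PreBounded N r t (-p) := ⟨by simpa [sub_eq_add_neg] using h.2, by simpa using h.1⟩

theorem PreBounded.add {s t : ℝ} {p q : MvPolynomial (Fin N) ℝ} (hp : PreBounded N r s p)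
    (hq : PreBounded N r t q) : PreBounded N r (s + t) (p + q) := by
  constructor
  · convert hp.1.add hq.1 using 1; simp; ring
  · convert hp.2.add hq.2 using 1; simp; ring

theorem PreBounded.mono {s t : ℝ} {p : MvPolynomial (Fin N) ℝ} (hp : PreBounded N r s p)
    (hst : s ≤ t) : PreBounded N r t p := by
  have hC := inPreSimplex_C (N := N) (r := r) (sub_nonneg.2 hst)
  constructor
  · convert hC.add hp.1 using 1; simp; ring
  · convert hC.add hp.2 using 1; simp

theorem PreBounded.C_mul {t : ℝ} {p : MvPolynomial (Fin N) ℝ} (hp : PreBounded N r t p)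
    (c : ℝ) : PreBounded N r (|c| * t) (C c * p) := by
  rcases le_total 0 c with hc | hc
  · rw [abs_of_nonneg hc]
    constructor
    · convert hp.1.C_mul hc using 1; simp; ring
    · convert hp.2.C_mul hc using 1; simp; ring
  · rw [abs_of_nonpos hc]
    constructor
    · convert hp.2.C_mul (neg_nonneg.2 hc) using 1; simp; ring
    · convert hp.1.C_mul (neg_nonneg.2 hc) using 1; simp; ring

theorem PreBounded.sum {κ : Type*} {s : Finset κ} {t : κ → ℝ} {p : κ → MvPolynomial (Fin N) ℝ}
    (hp : ∀ i ∈ s, PreBounded N r (t i) (p i)) :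
    PreBounded N r (∑ i ∈ s, t i) (∑ i ∈ s, p i) := by
  classical
  induction s using Finset.induction_on with
  | empty => simpa using preBounded_zero
  | insert a s ha ih =>
    rw [Finset.sum_insert ha, Finset.sum_insert ha]
    exact (hp a (by simp)).add (ih fun i hi => hp i (by simp [hi]))

end Preordering

section GaussianMoments

open MeasureTheory Filter

/-- The moments of the standard normal distribution. -/
def gaussMoment : ℕ → ℝ
  | 0 => 1
  | 1 => 0
  | n + 2 => (n + 1) * gaussMoment n

theorem gaussMoment_of_odd {n : ℕ} (hn : n % 2 = 1) : gaussMoment n = 0 := by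
  induction n using gaussMoment.induct with
  | case1 => simp at hn
  | case2 => rfl
  | case3 n ih => rw [gaussMoment, ih (by omega), mul_zero]

theorem integrable_pow_mul_gauss (n : ℕ) :
    Integrable fun x : ℝ => x ^ n * Real.exp (-(1 / 2) * x ^ 2) := by
  simpa using integrable_rpow_mul_exp_neg_mul_sq (b := 1 / 2) (by norm_num) (s := n)
    (by have : (0 : ℝ) ≤ n := n.cast_nonneg
        linarith)

theorem hasDerivAt_pow_mul_gauss (n : ℕ) (x : ℝ) :
    HasDerivAt (fun x : ℝ => x ^ (n + 1) * Real.exp (-(1 / 2) * x ^ 2))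
      ((n + 1) * (x ^ n * Real.exp (-(1 / 2) * x ^ 2))
        - x ^ (n + 2) * Real.exp (-(1 / 2) * x ^ 2)) x := by
  have h := (hasDerivAt_pow (n + 1) x).mul (((hasDerivAt_pow 2 x).const_mul (-(1 / 2 : ℝ))).exp)
  refine h.congr_deriv ?_
  push_cast
  ring

theorem integral_pow_mul_gauss (n : ℕ) :
    ∫ x : ℝ, x ^ n * Real.exp (-(1 / 2) * x ^ 2) =
      gaussMoment n * √(Real.pi / (1 / 2)) := by
  induction n using gaussMoment.induct with
  | case1 => simp only [pow_zero, one_mul, gaussMoment, integral_gaussian]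
  | case2 =>
    have h := integral_neg_eq_self (fun x : ℝ => x ^ 1 * Real.exp (-(1 / 2) * x ^ 2)) volume
    have h' : ∀ x : ℝ, (-x) ^ 1 * Real.exp (-(1 / 2) * (-x) ^ 2) =
        -(x ^ 1 * Real.exp (-(1 / 2) * x ^ 2)) := fun x => by rw [neg_sq]; ring
    simp_rw [h', integral_neg] at h
    rw [gaussMoment]
    linarith
  | case3 n ih =>
    have h := integral_eq_zero_of_hasDerivAt_of_integrable (hasDerivAt_pow_mul_gauss n)
      (((integrable_pow_mul_gauss n).const_mul _).sub (integrable_pow_mul_gauss (n + 2)))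
      (integrable_pow_mul_gauss (n + 1))
    rw [integral_sub ((integrable_pow_mul_gauss n).const_mul _) (integrable_pow_mul_gauss (n + 2)),
      integral_const_mul, ih] at h
    rw [gaussMoment]
    linarith

variable {ι : Type*} [Fintype ι]

/-- The expectation of a polynomial in independent standard normal variables. -/
noncomputable def gaussE : MvPolynomial ι ℝ →ₗ[ℝ] ℝ :=
  (basisMonomials ι ℝ).constr ℝ fun s => ∏ i, gaussMoment (s i)

theorem gaussE_monomial (s : ι →₀ ℕ) (c : ℝ) :
    gaussE (monomial s c) = c * ∏ i, gaussMoment (s i) := by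
  have h : (monomial s c : MvPolynomial ι ℝ) = c • basisMonomials ι ℝ s := by
    simp [smul_monomial]
  rw [h, map_smul, gaussE, Module.Basis.constr_basis, smul_eq_mul]

theorem gaussE_one : gaussE (1 : MvPolynomial ι ℝ) = 1 := by
  have := gaussE_monomial (0 : ι →₀ ℕ) 1
  simpa [gaussMoment] using this

theorem gaussE_C_mul (c : ℝ) (p : MvPolynomial ι ℝ) : gaussE (C c * p) = c * gaussE p := by
  rw [C_mul', map_smul, smul_eq_mul]

theorem integral_eval_mul_gauss (p : MvPolynomial ι ℝ) :
    (Integrable fun w : ι → ℝ => eval w p * ∏ i, Real.exp (-(1 / 2) * w i ^ 2)) ∧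
    ∫ w : ι → ℝ, eval w p * ∏ i, Real.exp (-(1 / 2) * w i ^ 2) =
      gaussE p * ∏ _i : ι, √(Real.pi / (1 / 2)) := by
  induction p using MvPolynomial.induction_on' with
  | monomial s c =>
    have h : (fun w : ι → ℝ => eval w (monomial s c) * ∏ i, Real.exp (-(1 / 2) * w i ^ 2)) =
        fun w => c * ∏ i, (w i ^ s i * Real.exp (-(1 / 2) * w i ^ 2)) := by
      ext w
      rw [eval_monomial, Finsupp.prod_fintype _ _ (by simp), mul_assoc, Finset.prod_mul_distrib]
    rw [h]
    refine ⟨(Integrable.fintype_prod (f := fun i (x : ℝ) => x ^ s i * Real.exp (-(1 / 2) * x ^ 2))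
      fun i => integrable_pow_mul_gauss (s i)).const_mul c, ?_⟩
    rw [integral_const_mul, integral_fintype_prod_volume_eq_prod
      (fun i (x : ℝ) => x ^ s i * Real.exp (-(1 / 2) * x ^ 2)), gaussE_monomial]
    simp_rw [integral_pow_mul_gauss, Finset.prod_mul_distrib]
    ring
  | add p q hp hq =>
    simp_rw [map_add, add_mul]
    exact ⟨hp.1.add hq.1, by rw [integral_add hp.1 hq.1, hp.2, hq.2]⟩

theorem gaussE_nonneg {p : MvPolynomial ι ℝ} (hp : ∀ w, 0 ≤ eval w p) : 0 ≤ gaussE p := by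
  have hpos : (0 : ℝ) < ∏ _i : ι, √(Real.pi / (1 / 2)) :=
    Finset.prod_pos fun _ _ => Real.sqrt_pos.2 (by positivity)
  refine nonneg_of_mul_nonneg_left ?_ hpos
  rw [← (integral_eval_mul_gauss p).2]
  exact integral_nonneg fun w => mul_nonneg (hp w) (Finset.prod_nonneg fun i _ => Real.exp_nonneg _)

theorem gaussE_X_mul [DecidableEq ι] (i : ι) (p : MvPolynomial ι ℝ) :
    gaussE (X i * p) = gaussE (pderiv i p) := by
  induction p using MvPolynomial.induction_on' with
  | monomial s c =>
    rw [X, monomial_mul, pderiv_monomial, gaussE_monomial, gaussE_monomial, one_mul, mul_assoc]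
    congr 1
    rw [← Finset.mul_prod_erase _ _ (Finset.mem_univ i),
      ← Finset.mul_prod_erase _ (fun j => gaussMoment ((s - Finsupp.single i 1 : ι →₀ ℕ) j))
        (Finset.mem_univ i), ← mul_assoc]
    congr 1
    · rcases h : s i with _ | n
      · simp [h, gaussMoment]
      · simp [h, gaussMoment, add_comm 1 (n + 1)]
    · refine Finset.prod_congr rfl fun j hj => ?_
      have hji : j ≠ i := Finset.ne_of_mem_erase hj
      simp [hji.symm]
  | add p q hp hq => rw [mul_add, map_add, hp, hq, map_add, map_add]

/-- The substitution changing the sign of one variable. -/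
noncomputable def flipSign [DecidableEq ι] (i : ι) : MvPolynomial ι ℝ →ₐ[ℝ] MvPolynomial ι ℝ :=
  aeval fun j => if j = i then -X j else X j

theorem flipSign_monomial [DecidableEq ι] (i : ι) (s : ι →₀ ℕ) (c : ℝ) :
    flipSign i (monomial s c) = C ((-1) ^ s i) * monomial s c := by
  rw [flipSign, aeval_monomial, monomial_eq, Finsupp.prod_fintype _ _ (by simp),
    Finsupp.prod_fintype _ _ (by simp), algebraMap_eq, mul_left_comm]
  congr 1
  rw [← Finset.mul_prod_erase _ _ (Finset.mem_univ i),
    ← Finset.mul_prod_erase Finset.univ (fun j => (X j : MvPolynomial ι ℝ) ^ s j)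
      (Finset.mem_univ i), ← mul_assoc]
  congr 1
  · rw [if_pos rfl, neg_pow]; simp
  · exact Finset.prod_congr rfl fun j hj => by rw [if_neg (Finset.ne_of_mem_erase hj)]

theorem gaussE_flipSign [DecidableEq ι] (i : ι) (p : MvPolynomial ι ℝ) :
    gaussE (flipSign i p) = gaussE p := by
  induction p using MvPolynomial.induction_on' with
  | monomial s c =>
    rw [flipSign_monomial, gaussE_C_mul, gaussE_monomial]
    rcases Nat.mod_two_eq_zero_or_one (s i) with h | h
    · rw [(Nat.even_iff.2 h).neg_one_pow, one_mul]
    · rw [Finset.prod_eq_zero (Finset.mem_univ i) (gaussMoment_of_odd h)]; simp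
  | add p q hp hq => rw [map_add, map_add, hp, hq, map_add]

theorem gaussE_eq_zero_of_flipSign [DecidableEq ι] {i : ι} {p : MvPolynomial ι ℝ}
    (hp : flipSign i p = -p) : gaussE p = 0 := by
  have h := gaussE_flipSign i p
  rw [hp, map_neg] at h
  linarith

/-- The polynomial `∑ i, X i ^ 2`. -/
noncomputable def sqNorm (ι : Type*) [Fintype ι] : MvPolynomial ι ℝ := ∑ i, X i ^ 2

theorem flipSign_sqNorm [DecidableEq ι] (i : ι) : flipSign i (sqNorm ι) = sqNorm ι := by
  simp only [sqNorm, map_sum, map_pow, flipSign, aeval_X]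
  exact Finset.sum_congr rfl fun j _ => by split_ifs <;> simp

theorem isHomogeneous_sqNorm : (sqNorm ι).IsHomogeneous 2 :=
  IsHomogeneous.sum _ _ _ fun i _ => by simpa using (isHomogeneous_X ℝ i).pow 2

theorem gaussE_sqNorm_mul {p : MvPolynomial ι ℝ} {n : ℕ} (hp : p.IsHomogeneous n) :
    gaussE (sqNorm ι * p) = (Fintype.card ι + n) * gaussE p := by
  classical
  have h : ∀ i : ι, gaussE (X i ^ 2 * p) = gaussE p + gaussE (X i * pderiv i p) := fun i => by
    rw [sq, mul_assoc, gaussE_X_mul, Derivation.leibniz, pderiv_X_self, map_add, add_comm]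
    simp
  rw [sqNorm, Finset.sum_mul, map_sum, Finset.sum_congr rfl fun i _ => h i,
    Finset.sum_add_distrib, ← map_sum gaussE (fun i => X i * pderiv i p), hp.sum_X_mul_pderiv,
    map_nsmul, nsmul_eq_mul]
  simp [add_mul]

/-- The moment of order `2 * m` of the norm of a standard normal vector in dimension `D`. -/
noncomputable def normMoment (D m : ℕ) : ℝ := ∏ t ∈ Finset.range m, ((D : ℝ) + 2 * t)

theorem normMoment_succ (D m : ℕ) : normMoment D (m + 1) = normMoment D m * (D + 2 * m) :=
  Finset.prod_range_succ _ _

theorem normMoment_pos {D : ℕ} (hD : 0 < D) (m : ℕ) : 0 < normMoment D m :=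
  Finset.prod_pos fun t _ => by positivity

theorem gaussE_sqNorm_pow_mul {p : MvPolynomial ι ℝ} {m : ℕ} (hp : p.IsHomogeneous (2 * m))
    (j : ℕ) : gaussE (sqNorm ι ^ j * p) * normMoment (Fintype.card ι) m =
      normMoment (Fintype.card ι) (m + j) * gaussE p := by
  induction j with
  | zero => simp [mul_comm]
  | succ j ih =>
    have hh : (sqNorm ι ^ j * p).IsHomogeneous (2 * j + 2 * m) :=
      (isHomogeneous_sqNorm.pow j).mul hp
    rw [pow_succ', mul_assoc, gaussE_sqNorm_mul hh, mul_assoc, ih, ← add_assoc, normMoment_succ]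
    push_cast
    ring

end GaussianMoments

section Expansion

variable {ι : Type*}

theorem natCast_mul_gaussMoment (n k : ℕ) :
    (n : ℝ) * gaussMoment (n - 1 + k) =
      gaussMoment (n + (k + 1)) - k * gaussMoment (n + (k - 1)) := by
  rcases n with _ | n
  · rcases k with _ | k
    · simp [gaussMoment]
    · have : gaussMoment (0 + (k + 1 + 1)) = (k + 1) * gaussMoment k := by
        rw [zero_add, gaussMoment]
      rw [this]; simp
  · rcases k with _ | k
    · have : gaussMoment (n + 1 + (0 + 1)) = (n + 1) * gaussMoment n := by
        rw [show n + 1 + (0 + 1) = n + 2 by omega, gaussMoment]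
      rw [this]; simp
    · have : gaussMoment (n + 1 + (k + 1 + 1)) = (n + k + 1 + 1) * gaussMoment (n + k + 1) := by
        rw [show n + 1 + (k + 1 + 1) = n + k + 1 + 2 by omega, gaussMoment]; push_cast; ring
      rw [this, show n + 1 - 1 + (k + 1) = n + k + 1 by omega,
        show n + 1 + (k + 1 - 1) = n + k + 1 by omega]
      push_cast
      ring

/-- The function `(z, n) ↦ z ^ γ * m_{n + k}`, with `m` the Gaussian moments. -/
noncomputable def momentTerm (γ : ι →₀ ℕ) (k : ℕ) : (ι → ℝ) → ℕ → ℝ :=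
  fun z n => eval z (monomial γ 1) * gaussMoment (n + k)

/-- Admissible lower order terms in the expansion of the Gaussian expectation of
`ℓ ^ n * X ^ β`. -/
def IsLowerIndex (β γ : ι →₀ ℕ) (k : ℕ) : Prop :=
  (∀ i, γ i % 2 = β i % 2) ∧ γ.degree ≤ β.degree ∧ k + 2 ≤ β.degree ∧ k % 2 = β.degree % 2

/-- The span of the admissible lower order terms. -/
def lowerTerms (β : ι →₀ ℕ) : Submodule ℝ ((ι → ℝ) → ℕ → ℝ) :=
  Submodule.span ℝ {h | ∃ γ k, IsLowerIndex β γ k ∧ h = momentTerm γ k}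

theorem momentTerm_mem_lowerTerms {β γ : ι →₀ ℕ} {k : ℕ} (h : IsLowerIndex β γ k) :
    momentTerm γ k ∈ lowerTerms β := Submodule.subset_span ⟨γ, k, h, rfl⟩

theorem lowerTerms_le {β β' : ι →₀ ℕ} (hp : ∀ i, β i % 2 = β' i % 2)
    (hd : β.degree ≤ β'.degree) (hd' : β.degree % 2 = β'.degree % 2) :
    lowerTerms β ≤ lowerTerms β' := by
  refine Submodule.span_le.2 ?_
  rintro _ ⟨γ, k, ⟨h1, h2, h3, h4⟩, rfl⟩
  exact momentTerm_mem_lowerTerms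
    ⟨fun i => (h1 i).trans (hp i), h2.trans hd, h3.trans hd, h4.trans hd'⟩

theorem eval_monomial_add_single (z : ι → ℝ) (γ : ι →₀ ℕ) (i : ι) :
    eval z (monomial (γ + Finsupp.single i 1) (1 : ℝ)) = z i * eval z (monomial γ 1) := by
  rw [monomial_add_single, pow_one, map_mul, eval_X, mul_comm]

theorem shift_momentTerm (γ : ι →₀ ℕ) (k : ℕ) (i : ι) :
    (fun (z : ι → ℝ) (n : ℕ) => n * z i * momentTerm γ k z (n - 1)) =
      momentTerm (γ + Finsupp.single i 1) (k + 1)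
        - (k : ℝ) • momentTerm (γ + Finsupp.single i 1) (k - 1) := by
  ext z n
  simp only [momentTerm, Pi.sub_apply, Pi.smul_apply, smul_eq_mul, eval_monomial_add_single]
  linear_combination (z i * eval z (monomial γ 1)) * natCast_mul_gaussMoment n k

theorem shift_mem_lowerTerms {β : ι →₀ ℕ} (i : ι) {h : (ι → ℝ) → ℕ → ℝ}
    (hh : h ∈ lowerTerms β) :
    (fun (z : ι → ℝ) (n : ℕ) => n * z i * h z (n - 1)) ∈
      lowerTerms (β + Finsupp.single i 1) := by
  classical
  induction hh using Submodule.span_induction with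
  | mem h hh =>
    obtain ⟨γ, k, ⟨h1, h2, h3, h4⟩, rfl⟩ := hh
    have hpar : ∀ j, (γ + Finsupp.single i 1 : ι →₀ ℕ) j % 2 =
        (β + Finsupp.single i 1 : ι →₀ ℕ) j % 2 := fun j => by
      have := h1 j
      simp only [Finsupp.add_apply]
      omega
    rw [shift_momentTerm]
    refine Submodule.sub_mem _ (momentTerm_mem_lowerTerms ⟨hpar, ?_, ?_, ?_⟩) ?_
    · simpa using h2
    · simp; omega
    · simp; omega
    · rcases k with _ | k
      · simp
      · refine Submodule.smul_mem _ _ (momentTerm_mem_lowerTerms ⟨hpar, ?_, ?_, ?_⟩)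
        · simpa using h2
        · simp; omega
        · simp; omega
  | zero => convert Submodule.zero_mem _ using 3; simp
  | add f g _ _ hf hg =>
    convert Submodule.add_mem _ hf hg using 3
    simp [mul_add]
  | smul c f _ hf =>
    convert Submodule.smul_mem _ c hf using 3
    simp [mul_left_comm]

variable [Fintype ι]

/-- The linear form with coefficient vector `z`. -/
noncomputable def linForm (z : ι → ℝ) : MvPolynomial ι ℝ := ∑ i, C (z i) * X i

theorem isHomogeneous_linForm (z : ι → ℝ) : (linForm z).IsHomogeneous 1 :=
  IsHomogeneous.sum _ _ _ fun i _ => by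
    simpa using (isHomogeneous_C ι (z i)).mul (isHomogeneous_X ℝ i)

theorem pderiv_linForm [DecidableEq ι] (z : ι → ℝ) (i : ι) : pderiv i (linForm z) = C (z i) := by
  simp [linForm, pderiv_X, Pi.single_apply]

theorem gaussE_X_mul_linForm_pow_mul [DecidableEq ι] (z : ι → ℝ) (i : ι) (n : ℕ)
    (s : ι →₀ ℕ) :
    gaussE (X i * (linForm z ^ n * monomial s 1)) =
      n * z i * gaussE (linForm z ^ (n - 1) * monomial s 1) +
        s i * gaussE (linForm z ^ n * monomial (s - Finsupp.single i 1) 1) := by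
  rw [gaussE_X_mul, Derivation.leibniz, Derivation.leibniz_pow, pderiv_linForm, pderiv_monomial,
    map_add, add_comm]
  congr 1
  · rw [← gaussE_C_mul]
    congr 1
    simp only [smul_eq_mul, nsmul_eq_mul, C_mul, map_natCast]
    ring
  · rw [← gaussE_C_mul, smul_eq_mul, mul_left_comm, C_mul_monomial, mul_comm (1 : ℝ)]

theorem gaussE_linForm_pow {z : ι → ℝ} (hz : ∑ i, z i ^ 2 = 1) (n : ℕ) :
    gaussE (linForm z ^ n) = gaussMoment n := by
  classical
  have key : ∀ n : ℕ, gaussE (linForm z ^ (n + 1)) = n * gaussE (linForm z ^ (n - 1)) := by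
    intro n
    rw [pow_succ']
    nth_rw 1 [linForm]
    rw [Finset.sum_mul, map_sum]
    have h : ∀ i, gaussE (C (z i) * X i * linForm z ^ n) =
        z i ^ 2 * (n * gaussE (linForm z ^ (n - 1))) := fun i => by
      have := gaussE_X_mul_linForm_pow_mul z i n 0
      simp only [monomial_zero', map_one, mul_one, Finsupp.coe_zero, Pi.zero_apply, Nat.cast_zero,
        zero_mul, add_zero] at this
      rw [mul_assoc, gaussE_C_mul, this]
      ring
    rw [Finset.sum_congr rfl fun i _ => h i, ← Finset.sum_mul, hz, one_mul]
  induction n using gaussMoment.induct with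
  | case1 => simp [gaussE_one, gaussMoment]
  | case2 => simpa [gaussMoment] using key 0
  | case3 n ih =>
    rw [key (n + 1), Nat.add_sub_cancel, ih, gaussMoment]
    push_cast
    ring

theorem gaussE_linForm_pow_mul_monomial (β : ι →₀ ℕ) :
    ∃ h ∈ lowerTerms β, ∀ z : ι → ℝ, ∑ i, z i ^ 2 = 1 → ∀ n : ℕ,
      gaussE (linForm z ^ n * monomial β 1) = momentTerm β β.degree z n + h z n := by
  classical
  induction hD : β.degree using Nat.strong_induction_on generalizing β with
  | _ D ih =>
  rcases eq_or_ne β 0 with rfl | hβ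
  · refine ⟨0, Submodule.zero_mem _, fun z hz n => ?_⟩
    have : D = 0 := by simpa using hD.symm
    simp [momentTerm, gaussE_linForm_pow hz, this]
  obtain ⟨i, hi⟩ : ∃ i, β i ≠ 0 := by
    by_contra! hcon
    exact hβ (Finsupp.ext hcon)
  obtain ⟨β, rfl⟩ : ∃ β', β = β' + Finsupp.single i 1 :=
    ⟨β - Finsupp.single i 1, by
      ext j
      by_cases hj : j = i
      · subst hj; simp; omega
      · simp [Ne.symm hj]⟩
  have hD' : D = β.degree + 1 := by simpa using hD.symm
  obtain ⟨h₁, hm₁, he₁⟩ := ih β.degree (by omega) β rfl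
  have hlead : (fun (z : ι → ℝ) (n : ℕ) => n * z i * momentTerm β β.degree z (n - 1)) -
      momentTerm (β + Finsupp.single i 1) D ∈ lowerTerms (β + Finsupp.single i 1) := by
    rw [shift_momentTerm, ← hD', sub_sub_cancel_left]
    rcases hb : β.degree with _ | k
    · simp
    · refine Submodule.neg_mem _ (Submodule.smul_mem _ _ (momentTerm_mem_lowerTerms
        ⟨fun _ => rfl, le_rfl, ?_, ?_⟩))
      · simp; omega
      · simp; omega
  have hlow : ∃ h ∈ lowerTerms (β + Finsupp.single i 1), ∀ z : ι → ℝ, ∑ i, z i ^ 2 = 1 → ∀ n : ℕ,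
      β i * gaussE (linForm z ^ n * monomial (β - Finsupp.single i 1) 1) = h z n := by
    rcases Nat.eq_zero_or_pos (β i) with h0 | h0
    · exact ⟨0, Submodule.zero_mem _, by simp [h0]⟩
    obtain ⟨α, rfl⟩ : ∃ α, β = α + Finsupp.single i 1 :=
      ⟨β - Finsupp.single i 1, by
        ext j
        by_cases hj : j = i
        · subst hj; simp; omega
        · simp [Ne.symm hj]⟩
    have hα : (α + Finsupp.single i 1).degree = α.degree + 1 := by simp
    have hpar : ∀ j, α j % 2 =
        (α + Finsupp.single i 1 + Finsupp.single i 1 : ι →₀ ℕ) j % 2 := fun j => by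
      simp only [Finsupp.add_apply, Finsupp.single_apply]
      split_ifs <;> omega
    obtain ⟨h₂, hm₂, he₂⟩ := ih α.degree (by omega) α rfl
    refine ⟨((α + Finsupp.single i 1 : ι →₀ ℕ) i : ℝ) • (momentTerm α α.degree + h₂),
      Submodule.smul_mem _ _ (Submodule.add_mem _ (momentTerm_mem_lowerTerms
        ⟨hpar, ?_, ?_, ?_⟩) (lowerTerms_le hpar ?_ ?_ hm₂)), fun z hz n => ?_⟩
    · simp; omega
    · simp
    · simp; omega
    · simp; omega
    · simp; omega
    · rw [add_tsub_cancel_right, he₂ z hz n]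
      simp
  obtain ⟨h₂, hm₂, he₂⟩ := hlow
  refine ⟨_, Submodule.add_mem _ (Submodule.add_mem _ hlead (shift_mem_lowerTerms i hm₁)) hm₂,
    fun z hz n => ?_⟩
  have hmul : linForm z ^ n * monomial (β + Finsupp.single i 1) (1 : ℝ) =
      X i * (linForm z ^ n * monomial β 1) := by
    rw [monomial_add_single, pow_one]; ring
  rw [hmul, gaussE_X_mul_linForm_pow_mul, he₂ z hz n, he₁ z hz (n - 1)]
  simp only [Pi.add_apply, Pi.sub_apply]
  ring

end Expansion

section TrigKernel

open intervalIntegral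

/-- The trigonometric moment `∫ cos ^ (2 a) * sin ^ (M + 2 b)` over `[0, π / 2]`. -/
noncomputable def trigMoment (M a b : ℕ) : ℝ :=
  ∫ φ in (0 : ℝ)..(Real.pi / 2), Real.cos φ ^ (2 * a) * Real.sin φ ^ (M + 2 * b)

theorem trigMoment_add (M a b : ℕ) :
    trigMoment M (a + 1) b + trigMoment M a (b + 1) = trigMoment M a b := by
  unfold trigMoment
  rw [← integral_add (by apply Continuous.intervalIntegrable; fun_prop)
    (by apply Continuous.intervalIntegrable; fun_prop)]
  refine integral_congr fun φ _ => ?_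
  have h := Real.sin_sq_add_cos_sq φ
  rw [show 2 * (a + 1) = 2 * a + 2 by ring, show M + 2 * (b + 1) = M + 2 * b + 2 by ring, pow_add,
    pow_add _ (M + 2 * b)]
  linear_combination (Real.cos φ ^ (2 * a) * Real.sin φ ^ (M + 2 * b)) * h

theorem trigMoment_parts (M a b : ℕ) :
    (M + 2 * b + 1 : ℝ) * trigMoment M (a + 1) b = (2 * a + 1) * trigMoment M a (b + 1) := by
  have hderiv : ∀ φ : ℝ, HasDerivAt
      (fun φ => Real.cos φ ^ (2 * a + 1) * Real.sin φ ^ (M + 2 * b + 1))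
      ((M + 2 * b + 1 : ℝ) * (Real.cos φ ^ (2 * (a + 1)) * Real.sin φ ^ (M + 2 * b)) -
        (2 * a + 1) * (Real.cos φ ^ (2 * a) * Real.sin φ ^ (M + 2 * (b + 1)))) φ := by
    intro φ
    refine (((Real.hasDerivAt_cos φ).pow (2 * a + 1)).mul
      ((Real.hasDerivAt_sin φ).pow (M + 2 * b + 1))).congr_deriv ?_
    simp only [Nat.add_sub_cancel, Pi.pow_apply]
    push_cast
    rw [show 2 * (a + 1) = 2 * a + 2 by ring, show M + 2 * (b + 1) = M + 2 * b + 2 by ring]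
    ring
  have h := integral_eq_sub_of_hasDerivAt (a := 0) (b := Real.pi / 2) (fun φ _ => hderiv φ)
    (by apply Continuous.intervalIntegrable; fun_prop)
  rw [integral_sub (by apply Continuous.intervalIntegrable; fun_prop)
    (by apply Continuous.intervalIntegrable; fun_prop), integral_const_mul, integral_const_mul] at h
  simp only [Real.cos_pi_div_two, Real.sin_zero] at h
  rw [zero_pow (by omega), zero_pow (by omega)] at h
  unfold trigMoment
  linarith

theorem trigMoment_zero_pos (M : ℕ) : 0 < trigMoment M 0 0 := by
  unfold trigMoment
  refine intervalIntegral_pos_of_pos_on (by apply Continuous.intervalIntegrable; fun_prop) ?_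
    (by positivity)
  intro φ hφ
  have := Real.sin_pos_of_pos_of_lt_pi hφ.1 (by linarith [hφ.2, Real.pi_pos])
  simpa using pow_pos this M

theorem trigMoment_eq (M a b : ℕ) :
    trigMoment M a b = trigMoment M 0 0 * normMoment (M + 1) b * gaussMoment (2 * a) /
      normMoment (M + 2) (a + b) := by
  have hpos : ∀ {D : ℕ}, 0 < D → ∀ m, 0 < normMoment D m := normMoment_pos
  induction a with
  | zero =>
    induction b with
    | zero => simp [normMoment, gaussMoment]
    | succ b ih =>
      have h1 := trigMoment_add M 0 b
      have h2 := trigMoment_parts M 0 b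
      rw [ih] at h1
      simp only [Nat.mul_zero, zero_add] at *
      rw [normMoment_succ, normMoment_succ]
      have := (hpos (show 0 < M + 2 by omega) b).ne'
      push_cast at *
      field_simp at *
      linear_combination (M + 2 * b + 1) * h1 - normMoment (M + 2) b * h2
  | succ a ih =>
    have h1 := trigMoment_add M a b
    have h2 := trigMoment_parts M a b
    rw [ih] at h1
    rw [show a + 1 + b = a + b + 1 by ring, normMoment_succ, show 2 * (a + 1) = 2 * a + 2 by ring,
      gaussMoment]
    have := (hpos (show 0 < M + 2 by omega) (a + b)).ne'
    push_cast at *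
    field_simp at *
    linear_combination (2 * a + 1) * h1 + normMoment (M + 2) (a + b) * h2

/-- The polynomial `Q` with `Q (cos² φ) * sin² φ = sin² (n φ)`. -/
theorem exists_fejer_polynomial (n : ℕ) (hn : 0 < n) : ∃ Q : Polynomial ℝ, Q.natDegree ≤ n - 1 ∧
    ∀ φ : ℝ, Q.eval (Real.cos φ ^ 2) * Real.sin φ ^ 2 = Real.sin (n * φ) ^ 2 := by
  set P : Polynomial ℝ :=
    Polynomial.C (1 / 2) *
      (1 - (Polynomial.Chebyshev.T ℝ n).comp (Polynomial.C 2 * Polynomial.X - Polynomial.C 1)) with hP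
  have heval : ∀ φ : ℝ, P.eval (Real.cos φ ^ 2) = Real.sin (n * φ) ^ 2 := by
    intro φ
    have : 2 * Real.cos φ ^ 2 - 1 = Real.cos (2 * φ) := (Real.cos_two_mul φ).symm
    simp only [hP, Polynomial.eval_mul, Polynomial.eval_C, Polynomial.eval_sub, Polynomial.eval_one,
      Polynomial.eval_comp, Polynomial.eval_X, this, Polynomial.Chebyshev.T_real_cos]
    rw [show ((n : ℤ) : ℝ) * (2 * φ) = 2 * (n * φ) by push_cast; ring, Real.cos_two_mul,
      Real.sin_sq]
    ring
  have hdeg : P.natDegree ≤ n := by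
    refine (Polynomial.natDegree_C_mul_le _ _).trans ((Polynomial.natDegree_sub_le _ _).trans
      (max_le (by simp) (Polynomial.natDegree_comp_le.trans ?_)))
    have h1 : (Polynomial.C 2 * Polynomial.X - Polynomial.C 1 : Polynomial ℝ).natDegree ≤ 1 := by
      compute_degree
    have h2 : (Polynomial.Chebyshev.T ℝ n).natDegree = n := by
      simp
    rw [h2]
    nlinarith
  have hroot : P.IsRoot 1 := by
    have := heval 0
    simpa using this
  have hmul := Polynomial.mul_divByMonic_eq_iff_isRoot.2 hroot
  refine ⟨-(P /ₘ (Polynomial.X - Polynomial.C 1)), ?_, fun φ => ?_⟩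
  · rw [Polynomial.natDegree_neg, Polynomial.natDegree_divByMonic _ (Polynomial.monic_X_sub_C 1),
      Polynomial.natDegree_X_sub_C]
    omega
  · have h := congrArg (Polynomial.eval (Real.cos φ ^ 2)) hmul
    rw [heval, Polynomial.eval_mul] at h
    rw [← h, Real.sin_sq]
    simp
    ring

end TrigKernel

section TrigKernel

open intervalIntegral

theorem two_div_pi_mul_le_sin {x : ℝ} (h0 : 0 ≤ x) (h1 : x ≤ Real.pi / 2) :
    2 / Real.pi * x ≤ Real.sin x := Real.mul_le_sin h0 h1

theorem fejer_upper_pointwise {M n k : ℕ} (hn : 0 < n) (hk : M + 4 ≤ 4 * k) {Q : Polynomial ℝ}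
    (hQ : ∀ φ : ℝ, Q.eval (Real.cos φ ^ 2) * Real.sin φ ^ 2 = Real.sin (n * φ) ^ 2)
    {φ : ℝ} (hφ : φ ∈ Set.Icc 0 (Real.pi / 2)) :
    Q.eval (Real.cos φ ^ 2) ^ (2 * k) * Real.sin φ ^ (M + 2) ≤
      (1 / (n : ℝ) ^ 2) * (Q.eval (Real.cos φ ^ 2) ^ (2 * k) * Real.sin φ ^ M) +
        (n : ℝ) ^ (4 * k - M - 4) * (2 * n ^ 2) * (1 / (1 + (2 * n / Real.pi * φ) ^ 2)) := by
  have hn' : (0 : ℝ) < n := by exact_mod_cast hn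
  have hs0 : 0 ≤ Real.sin φ :=
    Real.sin_nonneg_of_nonneg_of_le_pi hφ.1 (by linarith [hφ.2, Real.pi_pos])
  have heven : ∀ y : ℝ, 0 ≤ y ^ (2 * k) := fun y => (even_two_mul k).pow_nonneg y
  rcases le_or_gt (Real.sin φ) (1 / n) with hs | hs
  · have hsq : Real.sin φ ^ 2 ≤ 1 / (n : ℝ) ^ 2 := by
      rw [← one_div_pow]; gcongr
    have h1 : Q.eval (Real.cos φ ^ 2) ^ (2 * k) * Real.sin φ ^ (M + 2) ≤
        (1 / (n : ℝ) ^ 2) * (Q.eval (Real.cos φ ^ 2) ^ (2 * k) * Real.sin φ ^ M) := by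
      rw [pow_add, ← mul_assoc, mul_comm]
      exact mul_le_mul_of_nonneg_right hsq (mul_nonneg (heven _) (pow_nonneg hs0 _))
    have h2 : 0 ≤ (n : ℝ) ^ (4 * k - M - 4) * (2 * n ^ 2) *
        (1 / (1 + (2 * n / Real.pi * φ) ^ 2)) := by positivity
    linarith
  · have hspos : 0 < Real.sin φ := lt_trans (by positivity) hs
    have hns : 1 < n * Real.sin φ := by
      rw [div_lt_iff₀ hn'] at hs; linarith
    have h0 : 0 ≤ (1 / (n : ℝ) ^ 2) * (Q.eval (Real.cos φ ^ 2) ^ (2 * k) * Real.sin φ ^ M) :=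
      mul_nonneg (by positivity) (mul_nonneg (heven _) (pow_nonneg hs0 _))
    have hpow : Q.eval (Real.cos φ ^ 2) ^ (2 * k) * Real.sin φ ^ (4 * k) ≤ 1 := by
      rw [show 4 * k = 2 * (2 * k) by ring, pow_mul (Real.sin φ), ← mul_pow, hQ]
      exact pow_le_one₀ (sq_nonneg _) (Real.sin_sq_le_one _)
    have hden : 1 + (2 * n / Real.pi * φ) ^ 2 ≤ 2 * (n * Real.sin φ) ^ 2 := by
      have h3 : 2 * n / Real.pi * φ ≤ n * Real.sin φ := by
        have := mul_le_mul_of_nonneg_left (two_div_pi_mul_le_sin hφ.1 hφ.2) hn'.le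
        calc _ = n * (2 / Real.pi * φ) := by ring
          _ ≤ _ := this
      have h4 : 0 ≤ 2 * n / Real.pi * φ := mul_nonneg (by positivity) hφ.1
      nlinarith
    have hone : Real.sin φ ^ (M + 2) ≤
        (n : ℝ) ^ (4 * k - M - 4) * (2 * n ^ 2) * (1 / (1 + (2 * n / Real.pi * φ) ^ 2)) *
          Real.sin φ ^ (4 * k) := by
      obtain ⟨m, hm⟩ : ∃ m, 4 * k = M + 4 + m := Nat.exists_eq_add_of_le hk
      rw [hm, show M + 4 + m - M - 4 = m by omega]
      have h5 : 1 ≤ (n * Real.sin φ) ^ m := one_le_pow₀ hns.le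
      have h6 : 1 ≤ 2 * (n * Real.sin φ) ^ 2 * (1 / (1 + (2 * n / Real.pi * φ) ^ 2)) := by
        rw [mul_one_div, one_le_div (by positivity)]
        exact hden
      calc Real.sin φ ^ (M + 2) = Real.sin φ ^ (M + 2) * (1 * 1) := by ring
        _ ≤ Real.sin φ ^ (M + 2) * ((n * Real.sin φ) ^ m *
            (2 * (n * Real.sin φ) ^ 2 * (1 / (1 + (2 * n / Real.pi * φ) ^ 2)))) := by gcongr
        _ = _ := by rw [pow_add _ (M + 4), pow_add, pow_add]; ring
    calc Q.eval (Real.cos φ ^ 2) ^ (2 * k) * Real.sin φ ^ (M + 2)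
        ≤ Q.eval (Real.cos φ ^ 2) ^ (2 * k) * _ := mul_le_mul_of_nonneg_left hone (heven _)
      _ = (n : ℝ) ^ (4 * k - M - 4) * (2 * n ^ 2) * (1 / (1 + (2 * n / Real.pi * φ) ^ 2)) *
          (Q.eval (Real.cos φ ^ 2) ^ (2 * k) * Real.sin φ ^ (4 * k)) := by ring
      _ ≤ (n : ℝ) ^ (4 * k - M - 4) * (2 * n ^ 2) * (1 / (1 + (2 * n / Real.pi * φ) ^ 2)) * 1 :=
          mul_le_mul_of_nonneg_left hpow (by positivity)
      _ ≤ _ := by linarith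

theorem integral_one_div_one_add_sq_le {n : ℕ} (hn : 0 < n) :
    ∫ φ in (0 : ℝ)..(Real.pi / 2), 1 / (1 + (2 * n / Real.pi * φ) ^ 2) ≤
      Real.pi ^ 2 / (4 * n) := by
  have hn' : (0 : ℝ) < n := by exact_mod_cast hn
  have hc : 2 * n / Real.pi ≠ 0 := by positivity
  rw [integral_comp_mul_left (fun x : ℝ => 1 / (1 + x ^ 2)) hc, integral_one_div_one_add_sq,
    smul_eq_mul, mul_zero, Real.arctan_zero, sub_zero]
  have h := (Real.arctan_lt_pi_div_two (2 * n / Real.pi * (Real.pi / 2))).le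
  calc _ ≤ (2 * n / Real.pi)⁻¹ * (Real.pi / 2) := by gcongr
    _ = _ := by field_simp; norm_num

theorem fejer_integral_upper {M n k : ℕ} (hn : 0 < n) (hk : M + 4 ≤ 4 * k) {Q : Polynomial ℝ}
    (hQ : ∀ φ : ℝ, Q.eval (Real.cos φ ^ 2) * Real.sin φ ^ 2 = Real.sin (n * φ) ^ 2) :
    ∫ φ in (0 : ℝ)..(Real.pi / 2), Q.eval (Real.cos φ ^ 2) ^ (2 * k) * Real.sin φ ^ (M + 2) ≤
      (1 / (n : ℝ) ^ 2) *
        (∫ φ in (0 : ℝ)..(Real.pi / 2), Q.eval (Real.cos φ ^ 2) ^ (2 * k) * Real.sin φ ^ M) +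
      (1 / (n : ℝ) ^ 2) * (Real.pi ^ 2 / 2 * (n : ℝ) ^ (4 * k - M - 1)) := by
  have hn' : (0 : ℝ) < n := by exact_mod_cast hn
  have hQc : Continuous fun φ : ℝ => Q.eval (Real.cos φ ^ 2) := by fun_prop
  have hfc : Continuous fun φ : ℝ => 1 / (1 + (2 * n / Real.pi * φ) ^ 2) := by
    refine Continuous.div continuous_const (by fun_prop) fun φ => ?_
    positivity
  have h := integral_mono_on (a := (0 : ℝ)) (b := Real.pi / 2) (μ := MeasureTheory.volume)
    (by positivity) (Continuous.intervalIntegrable (by fun_prop) _ _)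
    (Continuous.intervalIntegrable (by fun_prop) _ _)
    (fun φ hφ => fejer_upper_pointwise (M := M) hn hk hQ hφ)
  rw [integral_add (Continuous.intervalIntegrable (by fun_prop) _ _)
    (Continuous.intervalIntegrable (by fun_prop) _ _), integral_const_mul, integral_const_mul] at h
  refine h.trans (add_le_add le_rfl ?_)
  obtain ⟨m, hm⟩ : ∃ m, 4 * k = M + 4 + m := Nat.exists_eq_add_of_le hk
  rw [hm, show M + 4 + m - M - 4 = m by omega, show M + 4 + m - M - 1 = m + 3 by omega]
  calc _ ≤ (n : ℝ) ^ m * (2 * n ^ 2) * (Real.pi ^ 2 / (4 * n)) :=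
        mul_le_mul_of_nonneg_left (integral_one_div_one_add_sq_le hn) (by positivity)
    _ = _ := by field_simp; ring

theorem fejer_integral_lower (M k : ℕ) : ∃ c : ℝ, 0 < c ∧ ∀ n : ℕ, 0 < n →
    ∀ Q : Polynomial ℝ,
    (∀ φ : ℝ, Q.eval (Real.cos φ ^ 2) * Real.sin φ ^ 2 = Real.sin (n * φ) ^ 2) →
    M + 1 ≤ 4 * k →
    c * (n : ℝ) ^ (4 * k - M - 1) ≤
      ∫ φ in (0 : ℝ)..(Real.pi / 2), Q.eval (Real.cos φ ^ 2) ^ (2 * k) * Real.sin φ ^ M := by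
  refine ⟨(2 / Real.pi) ^ (4 * k) * (2 / Real.pi) ^ M / (M + 1), by positivity, ?_⟩
  intro n hn Q hQ hk
  have hn' : (0 : ℝ) < n := by exact_mod_cast hn
  have hn1 : (1 : ℝ) ≤ n := by exact_mod_cast hn
  have hQc : Continuous fun φ : ℝ => Q.eval (Real.cos φ ^ 2) := by fun_prop
  have hle : (1 : ℝ) / n ≤ Real.pi / 2 := by
    rw [div_le_iff₀ hn']
    nlinarith [Real.pi_gt_three]
  have heven : ∀ y : ℝ, 0 ≤ y ^ (2 * k) := fun y => (even_two_mul k).pow_nonneg y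
  have hsub : ∫ φ in (0 : ℝ)..(1 / n), Q.eval (Real.cos φ ^ 2) ^ (2 * k) * Real.sin φ ^ M ≤
      ∫ φ in (0 : ℝ)..(Real.pi / 2), Q.eval (Real.cos φ ^ 2) ^ (2 * k) * Real.sin φ ^ M := by
    rw [← integral_add_adjacent_intervals (b := 1 / (n : ℝ)) (c := Real.pi / 2)
      (Continuous.intervalIntegrable (by fun_prop) _ _)
      (Continuous.intervalIntegrable (by fun_prop) _ _), le_add_iff_nonneg_right]
    refine integral_nonneg hle fun φ hφ => mul_nonneg (heven _) (pow_nonneg ?_ _)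
    exact Real.sin_nonneg_of_nonneg_of_le_pi (le_trans (by positivity) hφ.1)
      (by linarith [hφ.2, Real.pi_pos])
  have hlow : ∫ φ in (0 : ℝ)..(1 / n),
        ((2 / Real.pi) ^ (4 * k) * (2 / Real.pi) ^ M * (n : ℝ) ^ (4 * k)) * φ ^ M ≤
      ∫ φ in (0 : ℝ)..(1 / n), Q.eval (Real.cos φ ^ 2) ^ (2 * k) * Real.sin φ ^ M := by
    refine integral_mono_on_of_le_Ioo (by positivity)
      (Continuous.intervalIntegrable (by fun_prop) _ _)
      (Continuous.intervalIntegrable (by fun_prop) _ _) fun φ hφ => ?_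
    have hnφ : n * φ ≤ 1 := by
      have := hφ.2
      rw [lt_div_iff₀ hn'] at this
      linarith
    have hs := two_div_pi_mul_le_sin hφ.1.le (hφ.2.le.trans hle)
    have hsn := two_div_pi_mul_le_sin (mul_nonneg hn'.le hφ.1.le)
      (hnφ.trans (by linarith [Real.pi_gt_three]))
    have hspos : 0 < Real.sin φ := lt_of_lt_of_le (mul_pos (by positivity) hφ.1) hs
    have hQlow : (2 / Real.pi * n) ^ 2 ≤ Q.eval (Real.cos φ ^ 2) := by
      have h1 : (2 / Real.pi * n) ^ 2 * Real.sin φ ^ 2 ≤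
          Q.eval (Real.cos φ ^ 2) * Real.sin φ ^ 2 := by
        rw [hQ, ← mul_pow]
        refine pow_le_pow_left₀ (by positivity) (le_trans ?_ hsn) 2
        rw [mul_assoc]
        gcongr
        exact Real.sin_le hφ.1.le
      exact le_of_mul_le_mul_right h1 (by positivity)
    calc _ = ((2 / Real.pi * n) ^ 2) ^ (2 * k) * (2 / Real.pi * φ) ^ M := by
          rw [← pow_mul, show 2 * (2 * k) = 4 * k by ring]; ring
      _ ≤ _ := by
          have := hφ.1.le
          have := heven (Q.eval (Real.cos φ ^ 2))
          gcongr
  refine le_trans (le_of_eq ?_) (hlow.trans hsub)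
  rw [integral_const_mul, integral_pow]
  obtain ⟨m, hm⟩ : ∃ m, 4 * k = M + 1 + m := Nat.exists_eq_add_of_le hk
  rw [hm, show M + 1 + m - M - 1 = m by omega]
  simp only [ne_eq, Nat.add_eq_zero_iff, one_ne_zero, and_false, not_false_eq_true, zero_pow,
    sub_zero, one_div, inv_pow]
  field_simp
  try ring

/-- Normalised univariate kernels with second moment of order `1 / r ^ 2`. -/
theorem exists_trig_kernel (M : ℕ) : ∃ C : ℝ, 0 < C ∧ ∀ r : ℕ, 0 < r → ∃ q : Polynomial ℝ,
    q.natDegree ≤ r ∧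
    (∫ φ in (0 : ℝ)..(Real.pi / 2), q.eval (Real.cos φ ^ 2) ^ 2 * Real.sin φ ^ M) =
      trigMoment M 0 0 ∧
    (∫ φ in (0 : ℝ)..(Real.pi / 2), q.eval (Real.cos φ ^ 2) ^ 2 * Real.sin φ ^ (M + 2)) ≤
      C / (r : ℝ) ^ 2 := by
  obtain ⟨k, hk0, hk⟩ : ∃ k : ℕ, 0 < k ∧ M + 4 ≤ 4 * k := ⟨M + 4, by omega, by omega⟩
  obtain ⟨c, hc, hlow⟩ := fejer_integral_lower M k
  have hJ0 := trigMoment_zero_pos M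
  have hk' : (0 : ℝ) < k := by exact_mod_cast hk0
  refine ⟨trigMoment M 0 0 * (1 + Real.pi ^ 2 / (2 * c)) * (k : ℝ) ^ 2, by positivity, ?_⟩
  intro r hr
  set n := r / k + 1 with hn
  have hnpos : 0 < n := Nat.succ_pos _
  have hn' : (0 : ℝ) < n := by exact_mod_cast hnpos
  have hr' : (0 : ℝ) < r := by exact_mod_cast hr
  have hrn : (r : ℝ) ≤ k * n := by
    have : r < k * n := Nat.lt_mul_div_succ r hk0
    exact_mod_cast this.le
  obtain ⟨Q, hQdeg, hQ⟩ := exists_fejer_polynomial n hnpos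
  set J := ∫ φ in (0 : ℝ)..(Real.pi / 2), Q.eval (Real.cos φ ^ 2) ^ (2 * k) * Real.sin φ ^ M
    with hJ
  have hlowJ := hlow n hnpos Q hQ (by omega)
  have hJpos : 0 < J := lt_of_lt_of_le (by positivity) hlowJ
  have hsq : ∀ x : ℝ, (Polynomial.C (Real.sqrt (trigMoment M 0 0 / J)) * Q ^ k).eval x ^ 2 =
      trigMoment M 0 0 / J * Q.eval x ^ (2 * k) := by
    intro x
    rw [Polynomial.eval_mul, Polynomial.eval_C, mul_pow, Real.sq_sqrt (by positivity),
      Polynomial.eval_pow, ← pow_mul, mul_comm k]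
  refine ⟨Polynomial.C (Real.sqrt (trigMoment M 0 0 / J)) * Q ^ k, ?_, ?_, ?_⟩
  · refine (Polynomial.natDegree_C_mul_le _ _).trans (Polynomial.natDegree_pow_le.trans ?_)
    calc k * Q.natDegree ≤ k * (n - 1) := Nat.mul_le_mul_left _ hQdeg
      _ ≤ r := by rw [hn, Nat.add_sub_cancel]; exact Nat.mul_div_le r k
  · simp only [hsq, mul_assoc]
    rw [integral_const_mul, ← hJ]
    field_simp
  · simp only [hsq, mul_assoc]
    rw [integral_const_mul]
    have hup := fejer_integral_upper hnpos hk hQ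
    rw [← hJ] at hup
    have hb : Real.pi ^ 2 / 2 * (n : ℝ) ^ (4 * k - M - 1) ≤ Real.pi ^ 2 / (2 * c) * J := by
      calc _ = Real.pi ^ 2 / (2 * c) * (c * (n : ℝ) ^ (4 * k - M - 1)) := by field_simp
        _ ≤ _ := by gcongr
    calc _ ≤ trigMoment M 0 0 / J * (1 / (n : ℝ) ^ 2 * J +
          1 / (n : ℝ) ^ 2 * (Real.pi ^ 2 / (2 * c) * J)) := by
          refine mul_le_mul_of_nonneg_left (hup.trans ?_) (by positivity)
          gcongr
      _ = trigMoment M 0 0 * (1 + Real.pi ^ 2 / (2 * c)) * (1 / (n : ℝ) ^ 2) := by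
          field_simp
      _ ≤ trigMoment M 0 0 * (1 + Real.pi ^ 2 / (2 * c)) * ((k : ℝ) ^ 2 / (r : ℝ) ^ 2) := by
          gcongr ?_ * ?_
          rw [div_le_div_iff₀ (by positivity) (by positivity), one_mul, ← mul_pow]
          gcongr
      _ = _ := by ring

end TrigKernel

section KernelMoments

/-- The sum `∑ b k * b k' * g (k + k')` over `k, k' ≤ r`. -/
noncomputable def bilinSum (r : ℕ) (b g : ℕ → ℝ) : ℝ :=
  ∑ k ∈ Finset.range (r + 1), ∑ k' ∈ Finset.range (r + 1), b k * b k' * g (k + k')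

theorem bilinSum_add (r : ℕ) (b g g' : ℕ → ℝ) :
    bilinSum r b (fun n => g n + g' n) = bilinSum r b g + bilinSum r b g' := by
  simp [bilinSum, mul_add, Finset.sum_add_distrib]

theorem bilinSum_const_mul (r : ℕ) (b g : ℕ → ℝ) (c : ℝ) :
    bilinSum r b (fun n => c * g n) = c * bilinSum r b g := by
  simp [bilinSum, Finset.mul_sum, mul_left_comm]

theorem bilinSum_pow (r : ℕ) (q : Polynomial ℝ) (hq : q.natDegree ≤ r) (y : ℝ) :
    bilinSum r q.coeff (fun n => y ^ n) = q.eval y ^ 2 := by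
  rw [Polynomial.eval_eq_sum_range' (Nat.lt_succ_of_le hq), sq, Finset.sum_mul_sum, bilinSum]
  refine Finset.sum_congr rfl fun k _ => Finset.sum_congr rfl fun k' _ => ?_
  rw [pow_add]; ring

theorem bilinSum_trigMoment (M r i j : ℕ) (q : Polynomial ℝ) (hq : q.natDegree ≤ r) :
    bilinSum r q.coeff (fun n => trigMoment M (n + i) j) =
      ∫ φ in (0 : ℝ)..(Real.pi / 2),
        q.eval (Real.cos φ ^ 2) ^ 2 * (Real.cos φ ^ (2 * i) * Real.sin φ ^ (M + 2 * j)) := by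
  have h : ∀ φ : ℝ, q.eval (Real.cos φ ^ 2) ^ 2 *
      (Real.cos φ ^ (2 * i) * Real.sin φ ^ (M + 2 * j)) =
      ∑ k ∈ Finset.range (r + 1), ∑ k' ∈ Finset.range (r + 1), q.coeff k * q.coeff k' *
        (Real.cos φ ^ (2 * (k + k' + i)) * Real.sin φ ^ (M + 2 * j)) := by
    intro φ
    rw [← bilinSum_pow r q hq, bilinSum, Finset.sum_mul]
    refine Finset.sum_congr rfl fun k _ => ?_
    rw [Finset.sum_mul]
    refine Finset.sum_congr rfl fun k' _ => ?_
    rw [← pow_mul]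
    ring
  simp only [h]
  rw [intervalIntegral.integral_finsetSum
    fun k _ => Continuous.intervalIntegrable (by fun_prop) _ _]
  refine Finset.sum_congr rfl fun k _ => ?_
  rw [intervalIntegral.integral_finsetSum
    fun k' _ => Continuous.intervalIntegrable (by fun_prop) _ _]
  refine Finset.sum_congr rfl fun k' _ => ?_
  rw [intervalIntegral.integral_const_mul]
  simp only [trigMoment]

theorem exists_trigMoment_kernel (M : ℕ) : ∃ C : ℝ, 0 < C ∧ ∀ r : ℕ, 0 < r → ∃ b : ℕ → ℝ,
    (∀ i j, 0 ≤ bilinSum r b (fun n => trigMoment M (n + i) j)) ∧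
    bilinSum r b (fun n => trigMoment M (n + 0) 0) = trigMoment M 0 0 ∧
    bilinSum r b (fun n => trigMoment M (n + 0) 1) ≤ C / (r : ℝ) ^ 2 := by
  obtain ⟨C, hC, h⟩ := exists_trig_kernel M
  refine ⟨C, hC, fun r hr => ?_⟩
  obtain ⟨q, hq, h0, h1⟩ := h r hr
  refine ⟨q.coeff, fun i j => ?_, ?_, ?_⟩
  · rw [bilinSum_trigMoment M r i j q hq]
    refine intervalIntegral.integral_nonneg (by positivity) fun φ hφ => ?_
    have := Real.sin_nonneg_of_nonneg_of_le_pi hφ.1 (by linarith [hφ.2, Real.pi_pos])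
    have := Real.cos_nonneg_of_neg_pi_div_two_le_of_le (by linarith [hφ.1, Real.pi_pos]) hφ.2
    positivity
  · rw [bilinSum_trigMoment M r 0 0 q hq]
    simpa using h0
  · rw [bilinSum_trigMoment M r 0 1 q hq]
    simpa using h1

/-- The normalised Gaussian moments of the kernel with coefficients `b`. -/
noncomputable def kernelMoment (M r : ℕ) (b : ℕ → ℝ) (i j : ℕ) : ℝ :=
  bilinSum r b (fun n => gaussMoment (2 * (n + i)) / normMoment (M + 2) (n + i + j))

theorem one_le_normMoment {D : ℕ} (hD : 0 < D) (m : ℕ) : 1 ≤ normMoment D m := by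
  induction m with
  | zero => simp [normMoment]
  | succ m ih =>
    rw [normMoment_succ]
    have : (1 : ℝ) ≤ D := by exact_mod_cast hD
    have : (0 : ℝ) ≤ m := Nat.cast_nonneg m
    nlinarith

/-- Kernels whose moments are those of the identity up to `C / r ^ 2`. -/
def IsGoodKernel (M : ℕ) (C : ℝ) (r : ℕ) (b : ℕ → ℝ) : Prop :=
  (∀ i, |1 - kernelMoment M r b i 0| ≤ i * (C / (r : ℝ) ^ 2)) ∧
    ∀ i j, |kernelMoment M r b i (j + 1)| ≤ C / (r : ℝ) ^ 2

theorem exists_isGoodKernel (M : ℕ) : ∃ C : ℝ, 0 < C ∧ ∀ r : ℕ, 0 < r → ∃ b : ℕ → ℝ,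
    IsGoodKernel M C r b := by
  obtain ⟨C, hC, h⟩ := exists_trigMoment_kernel M
  have hJ0 := trigMoment_zero_pos M
  refine ⟨C / trigMoment M 0 0, by positivity, fun r hr => ?_⟩
  obtain ⟨b, hnn, h0, h1⟩ := h r hr
  refine ⟨b, ?_⟩
  have hκ : ∀ j, 0 < normMoment (M + 1) j := normMoment_pos (by omega)
  set T : ℕ → ℕ → ℝ := fun i j => bilinSum r b (fun n => trigMoment M (n + i) j) with hT
  have hrec : ∀ i j, T (i + 1) j + T i (j + 1) = T i j := by
    intro i j
    simp only [hT, ← bilinSum_add, ← add_assoc, trigMoment_add]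
  have hK : ∀ i j, kernelMoment M r b i j =
      1 / (trigMoment M 0 0 * normMoment (M + 1) j) * T i j := by
    intro i j
    have := hκ j
    simp only [hT, kernelMoment, ← bilinSum_const_mul]
    congr 1
    ext n
    rw [trigMoment_eq M (n + i) j]
    field_simp
  have hT1 : ∀ i, T i 1 ≤ C / (r : ℝ) ^ 2 := by
    intro i
    induction i with
    | zero => exact h1
    | succ i ih => linarith [hrec i 1, hnn i 2]
  have hTj : ∀ i j, T i (j + 1) ≤ C / (r : ℝ) ^ 2 := by
    intro i j
    induction j with
    | zero => exact hT1 i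
    | succ j ih => linarith [hrec i (j + 1), hnn (i + 1) (j + 1)]
  have hT0 : ∀ i, 0 ≤ trigMoment M 0 0 - T i 0 ∧
      trigMoment M 0 0 - T i 0 ≤ i * (C / (r : ℝ) ^ 2) := by
    intro i
    induction i with
    | zero => simp [hT, h0]
    | succ i ih =>
      have := hnn i 1
      have := hrec i 0
      have := hT1 i
      push_cast
      constructor <;> linarith
  refine ⟨fun i => ?_, fun i j => ?_⟩
  · have : 1 - kernelMoment M r b i 0 = (trigMoment M 0 0 - T i 0) / trigMoment M 0 0 := by
      rw [hK, show normMoment (M + 1) 0 = 1 by simp [normMoment]]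
      field_simp
    rw [this, abs_of_nonneg (div_nonneg (hT0 i).1 hJ0.le), div_le_iff₀ hJ0]
    refine (hT0 i).2.trans (le_of_eq ?_)
    field_simp
  · have h2 := hκ (j + 1)
    have h3 : 0 ≤ T i (j + 1) := hnn i (j + 1)
    rw [hK, abs_of_nonneg (by positivity)]
    calc _ ≤ 1 / (trigMoment M 0 0 * 1) * (C / (r : ℝ) ^ 2) := by
          gcongr
          · exact one_le_normMoment (by omega) _
          · exact hTj i j
      _ = _ := by field_simp

end KernelMoments

section LowerTerms

variable {M : ℕ}

theorem eval_monomial_two_nsmul {x : Fin (M + 1) → ℝ} {z : Option (Fin (M + 1)) → ℝ}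
    (hz : ∀ i, z i ^ 2 = eval x (simplexG (M + 1) i)) (γ : Option (Fin (M + 1)) →₀ ℕ) :
    eval z (monomial (2 • γ) 1) = eval x (∏ i, simplexG (M + 1) i ^ γ i) := by
  rw [eval_monomial, Finsupp.prod_fintype _ _ (by simp), one_mul, map_prod]
  refine Finset.prod_congr rfl fun i _ => ?_
  simp [pow_mul, hz]

theorem sum_sq_eq_one {x : Fin (M + 1) → ℝ} {z : Option (Fin (M + 1)) → ℝ}
    (hz : ∀ i, z i ^ 2 = eval x (simplexG (M + 1) i)) : ∑ i, z i ^ 2 = 1 := by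
  simp_rw [hz, ← map_sum, sum_simplexG, map_one]

theorem exists_preBounded_of_mem_lowerTerms {C₀ : ℝ}
    {α : Option (Fin (M + 1)) →₀ ℕ} {h : (Option (Fin (M + 1)) → ℝ) → ℕ → ℝ}
    (hh : h ∈ lowerTerms (2 • α)) :
    ∃ C : ℝ, ∀ r b, IsGoodKernel M C₀ r b → α.degree ≤ 2 * r →
      ∃ R : MvPolynomial (Fin (M + 1)) ℝ, PreBounded (M + 1) r (C / (r : ℝ) ^ 2) R ∧
        ∀ x z, (∀ i, z i ^ 2 = eval x (simplexG (M + 1) i)) →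
          eval x R = bilinSum r b (fun n => h z (2 * n) / normMoment (M + 2) (n + α.degree)) := by
  induction hh using Submodule.span_induction with
  | mem h hh =>
    obtain ⟨γ, k, ⟨h1, h2, h3, h4⟩, rfl⟩ := hh
    have hdeg : (2 • α).degree = 2 * α.degree := by simp
    rw [hdeg] at h2 h3 h4
    obtain ⟨i, rfl⟩ : ∃ i, k = 2 * i := ⟨k / 2, by omega⟩
    obtain ⟨j, hj⟩ : ∃ j, α.degree = i + j + 1 := ⟨α.degree - i - 1, by omega⟩
    obtain ⟨γ, rfl⟩ : ∃ γ', γ = 2 • γ' := by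
      refine ⟨γ.mapRange (· / 2) rfl, Finsupp.ext fun i => ?_⟩
      have := h1 i
      simp at this ⊢
      omega
    refine ⟨C₀, fun r b hb hr => ⟨C (kernelMoment M r b i (j + 1)) *
      ∏ i, simplexG (M + 1) i ^ γ i, ?_, fun x z hz => ?_⟩⟩
    · have hγ : ∑ i, γ i ≤ 2 * r := by
        have h5 : (2 • γ).degree = 2 * γ.degree := by simp
        have h6 : γ.degree = ∑ i, γ i := Finsupp.degree_eq_sum γ
        omega
      refine ((preBounded_prod_pow hγ).C_mul _).mono ?_
      rw [mul_one]
      exact hb.2 i j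
    · rw [map_mul, eval_C, mul_comm, kernelMoment, ← bilinSum_const_mul]
      congr 1
      ext n
      rw [momentTerm, eval_monomial_two_nsmul hz, hj, mul_div_assoc]
      congr 3 <;> ring
  | zero =>
    exact ⟨0, fun r b _ _ => ⟨0, by simpa using preBounded_zero, fun x z _ => by
      simp [bilinSum]⟩⟩
  | add f g _ _ hf hg =>
    obtain ⟨C₁, h₁⟩ := hf
    obtain ⟨C₂, h₂⟩ := hg
    refine ⟨C₁ + C₂, fun r b hb hr => ?_⟩
    obtain ⟨R₁, hR₁, he₁⟩ := h₁ r b hb hr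
    obtain ⟨R₂, hR₂, he₂⟩ := h₂ r b hb hr
    refine ⟨R₁ + R₂, by rw [add_div]; exact hR₁.add hR₂, fun x z hz => ?_⟩
    rw [map_add, he₁ x z hz, he₂ x z hz, ← bilinSum_add]
    simp [add_div]
  | smul c f _ hf =>
    obtain ⟨C₁, h₁⟩ := hf
    refine ⟨|c| * C₁, fun r b hb hr => ?_⟩
    obtain ⟨R₁, hR₁, he₁⟩ := h₁ r b hb hr
    refine ⟨C c * R₁, by rw [mul_div_assoc]; exact hR₁.C_mul c, fun x z hz => ?_⟩
    rw [map_mul, eval_C, he₁ x z hz, ← bilinSum_const_mul]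
    simp [mul_div_assoc]

/-- The kernel reproduces the monomial `∏ g ^ α` up to an error of order `1 / r ^ 2`. -/
theorem exists_preBounded_kernel_error (C₀ : ℝ) (α : Option (Fin (M + 1)) →₀ ℕ) :
    ∃ C : ℝ, ∀ r b, IsGoodKernel M C₀ r b → α.degree ≤ 2 * r →
      ∃ R : MvPolynomial (Fin (M + 1)) ℝ, PreBounded (M + 1) r (C / (r : ℝ) ^ 2) R ∧
        ∀ x z, (∀ i, z i ^ 2 = eval x (simplexG (M + 1) i)) →
          eval x R = eval x (∏ i, simplexG (M + 1) i ^ α i) -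
            bilinSum r b (fun n => gaussE (linForm z ^ (2 * n) * monomial (2 • α) 1) /
              normMoment (M + 2) (n + α.degree)) := by
  obtain ⟨h, hh, he⟩ := gaussE_linForm_pow_mul_monomial (2 • α)
  obtain ⟨C₁, h₁⟩ := exists_preBounded_of_mem_lowerTerms (C₀ := C₀) hh
  refine ⟨α.degree * C₀ + C₁, fun r b hb hr => ?_⟩
  obtain ⟨R₁, hR₁, he₁⟩ := h₁ r b hb hr
  have hα : ∑ i, α i ≤ 2 * r := by rwa [← Finsupp.degree_eq_sum]
  refine ⟨C (1 - kernelMoment M r b α.degree 0) * ∏ i, simplexG (M + 1) i ^ α i + -R₁, ?_,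
    fun x z hz => ?_⟩
  · rw [add_div]
    refine PreBounded.add (((preBounded_prod_pow hα).C_mul _).mono ?_) hR₁.neg
    rw [mul_one, mul_div_assoc]
    exact hb.1 _
  · simp only [he z (sum_sq_eq_one hz), add_div, bilinSum_add]
    rw [map_add, map_neg, he₁ x z hz, map_mul, eval_C, sub_mul, one_mul, kernelMoment,
      mul_comm (bilinSum _ _ _), ← bilinSum_const_mul]
    have : (fun n => eval x (∏ i, simplexG (M + 1) i ^ α i) *
        (gaussMoment (2 * (n + α.degree)) / normMoment (M + 2) (n + α.degree + 0))) =
        fun n => momentTerm (2 • α) (2 • α).degree z (2 * n) / normMoment (M + 2) (n + α.degree) := by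
      ext n
      rw [momentTerm, eval_monomial_two_nsmul hz, mul_div_assoc, add_zero]
      congr 3
      simp; ring
    rw [this]
    ring

end LowerTerms

section Membership

variable {κ σ ι : Type*} [Fintype ι]

/-- The Gram matrix of the polynomials `ρ` for the Gaussian weight times `F`. -/
noncomputable def gaussGram (ρ : κ → MvPolynomial ι ℝ) (F : MvPolynomial ι ℝ) : Matrix κ κ ℝ :=
  fun a b => gaussE (ρ a * ρ b * F)

theorem gaussGram_eq_zero [DecidableEq ι] {ρ : κ → MvPolynomial ι ℝ} {F : MvPolynomial ι ℝ}
    {e : κ → ι → ℕ} (hρ : ∀ i a, flipSign i (ρ a) = C ((-1) ^ e a i) * ρ a)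
    (hF : ∀ i, flipSign i F = F) {a b : κ} (hab : oddSupport (e a) ≠ oddSupport (e b)) :
    gaussGram ρ F a b = 0 := by
  obtain ⟨i, hi⟩ : ∃ i, e a i % 2 ≠ e b i % 2 := by
    by_contra! hcon
    exact hab (by ext i; simp [oddSupport, hcon i])
  refine gaussE_eq_zero_of_flipSign (i := i) ?_
  have hodd : (-1 : ℝ) ^ (e a i + e b i) = -1 := Odd.neg_one_pow (by
    rw [Nat.odd_iff]; omega)
  rw [map_mul, map_mul, hρ, hρ, hF]
  calc _ = C ((-1) ^ (e a i + e b i)) * (ρ a * ρ b * F) := by rw [pow_add, C_mul]; ring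
    _ = _ := by rw [hodd]; simp

variable [Fintype κ]

theorem isSOS_of_posSemidef {A : Matrix κ κ ℝ} (hA : A.PosSemidef)
    (p : κ → MvPolynomial σ ℝ) :
    ∃ (B : Matrix κ κ ℝ), ∑ a, ∑ b, C (A a b) * (p a * p b) =
      ∑ j, (∑ a, C (B j a) * p a) ^ 2 := by
  classical
  open scoped MatrixOrder Matrix.Norms.L2Operator in
  obtain ⟨B, rfl⟩ := CStarAlgebra.nonneg_iff_eq_star_mul_self.mp hA.nonneg
  refine ⟨B, ?_⟩
  have h : ∀ j, (∑ a, C (B j a) * p a) ^ 2 =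
      ∑ a, ∑ b, C (B j a * B j b) * (p a * p b) := by
    intro j
    rw [sq, Finset.sum_mul_sum]
    refine Finset.sum_congr rfl fun a _ => Finset.sum_congr rfl fun b _ => ?_
    rw [C_mul]; ring
  simp only [h]
  rw [eq_comm, Finset.sum_comm]
  refine Finset.sum_congr rfl fun a _ => ?_
  rw [Finset.sum_comm]
  refine Finset.sum_congr rfl fun b _ => ?_
  rw [Matrix.star_eq_conjTranspose, Matrix.mul_apply, map_sum, Finset.sum_mul]
  rfl

theorem gaussE_sq_mul (ρ : κ → MvPolynomial ι ℝ) (F : MvPolynomial ι ℝ) (v : κ → ℝ) :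
    gaussE ((∑ a, C (v a) * ρ a) ^ 2 * F) = ∑ a, ∑ b, gaussGram ρ F a b * (v a * v b) := by
  rw [sq, Finset.sum_mul_sum, Finset.sum_mul, map_sum]
  refine Finset.sum_congr rfl fun a _ => ?_
  rw [Finset.sum_mul, map_sum]
  refine Finset.sum_congr rfl fun b _ => ?_
  rw [gaussGram, mul_comm (gaussE _), ← gaussE_C_mul, C_mul]
  congr 1
  ring

theorem posSemidef_gaussGram (ρ : κ → MvPolynomial ι ℝ) {F : MvPolynomial ι ℝ}
    (hF : ∀ w, 0 ≤ eval w F) : (gaussGram ρ F).PosSemidef := by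
  refine Matrix.PosSemidef.of_dotProduct_mulVec_nonneg ?_ fun v => ?_
  · ext a b
    simp [gaussGram, mul_comm (ρ a)]
  · have h : 0 ≤ gaussE ((∑ a, C (v a) * ρ a) ^ 2 * F) :=
      gaussE_nonneg fun w => by
        rw [map_mul, map_pow]
        exact mul_nonneg (sq_nonneg _) (hF w)
    rw [gaussE_sq_mul] at h
    refine h.trans_eq ?_
    simp only [dotProduct, Matrix.mulVec, Finset.mul_sum, Pi.star_apply, star_trivial]
    exact Finset.sum_congr rfl fun a _ => Finset.sum_congr rfl fun b _ => by ring

/-- A Gaussian expectation which is a square in `z` and invariant under sign changes lies in the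
truncated preordering, as a function of `z ^ 2 = g`. -/
theorem exists_inPreSimplex_gaussE_sq {N r : ℕ} {ρ : κ → MvPolynomial (Option (Fin N)) ℝ}
    {F : MvPolynomial (Option (Fin N)) ℝ} {e : κ → Option (Fin N) → ℕ}
    (hρ : ∀ i a, flipSign i (ρ a) = C ((-1) ^ e a i) * ρ a)
    (hF : ∀ i, flipSign i F = F) (hF' : ∀ w, 0 ≤ eval w F)
    (he : ∀ a, ∑ i, e a i ≤ 2 * r) :
    ∃ P : MvPolynomial (Fin N) ℝ, InPreSimplex N r P ∧
      ∀ (x : Fin N → ℝ) (z : Option (Fin N) → ℝ), (∀ i, z i ^ 2 = eval x (simplexG N i)) →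
        eval x P = gaussE ((∑ a, C (∏ i, z i ^ e a i) * ρ a) ^ 2 * F) := by
  classical
  let p : Finset (Option (Fin N)) → κ → MvPolynomial (Fin N) ℝ := fun I a =>
    if oddSupport (e a) = I then ∏ i, simplexG N i ^ (e a i / 2) else 0
  have hdeg : ∀ I a, 2 * (p I a).totalDegree + I.card ≤ 2 * r ∨ p I a = 0 := by
    intro I a
    by_cases h : oddSupport (e a) = I
    · left
      have h1 : (p I a).totalDegree ≤ ∑ i, e a i / 2 := by
        simp only [p, if_pos h]
        exact totalDegree_prod_simplexG_pow_le _
      have h2 : I.card = ∑ i, e a i % 2 := by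
        rw [← h, oddSupport, Finset.card_filter]
        exact Finset.sum_congr rfl fun i _ => by
          split_ifs <;> omega
      have h3 : ∑ i, e a i = 2 * ∑ i, e a i / 2 + ∑ i, e a i % 2 := by
        rw [Finset.mul_sum, ← Finset.sum_add_distrib]
        exact Finset.sum_congr rfl fun i _ => by omega
      have := he a
      omega
    · right
      simp [p, h]
  have hmem : ∀ I, InPreSimplex N r ((∑ a, ∑ b, C (gaussGram ρ F a b) * (p I a * p I b)) *
      ∏ i ∈ I, simplexG N i) := by
    intro I
    obtain ⟨B, hB⟩ := isSOS_of_posSemidef (posSemidef_gaussGram ρ hF') (p I)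
    rw [hB]
    by_cases hcard : I.card ≤ 2 * r
    · refine inPreSimplex_of_isSOS_mul (isSOS_sum_sq _ _) ?_
      have h1 : (∏ i ∈ I, simplexG N i).totalDegree ≤ I.card :=
        (totalDegree_finsetProd _ _).trans
          ((Finset.sum_le_sum fun i _ => totalDegree_simplexG_le i).trans (by simp))
      have h2 : (∑ j, (∑ a, C (B j a) * p I a) ^ 2).totalDegree ≤ 2 * r - I.card := by
        refine totalDegree_finsetSum_le fun j _ => (totalDegree_pow _ _).trans ?_
        have h3 : (∑ a, C (B j a) * p I a).totalDegree ≤ (2 * r - I.card) / 2 := by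
          refine totalDegree_finsetSum_le fun a _ => ?_
          rw [C_mul']
          refine (totalDegree_smul_le _ _).trans ?_
          rcases hdeg I a with h | h
          · omega
          · simp [h]
        omega
      refine (totalDegree_mul _ _).trans ?_
      omega
    · have hz : ∀ a, p I a = 0 := fun a => (hdeg I a).resolve_left fun h => by omega
      simpa [hz] using inPreSimplex_zero
  refine ⟨∑ I, (∑ a, ∑ b, C (gaussGram ρ F a b) * (p I a * p I b)) * ∏ i ∈ I, simplexG N i,
    InPreSimplex.sum fun I _ => hmem I, fun x z hz => ?_⟩
  rw [gaussE_sq_mul]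
  simp only [map_sum, map_mul, eval_C, Finset.sum_mul]
  rw [Finset.sum_comm]
  refine Finset.sum_congr rfl fun a _ => ?_
  rw [Finset.sum_comm]
  refine Finset.sum_congr rfl fun b _ => ?_
  by_cases hab : oddSupport (e a) = oddSupport (e b)
  · rw [Finset.sum_eq_single (oddSupport (e a))]
    · rw [prod_pow_eq_sq_mul_prod_oddSupport z (e a),
        prod_pow_eq_sq_mul_prod_oddSupport z (e b), ← hab]
      simp only [p, if_pos, if_pos hab.symm, map_prod, map_pow, ← hz]
      have h1 : ∀ f : Option (Fin N) → ℕ, ∏ i, (z i ^ 2) ^ f i = (∏ i, z i ^ f i) ^ 2 := by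
        intro f
        rw [← Finset.prod_pow]
        exact Finset.prod_congr rfl fun i _ => by rw [← pow_mul, ← pow_mul, mul_comm]
      rw [h1, h1, Finset.prod_pow]
      ring
    · intro I _ hI
      simp [p, Ne.symm hI]
    · simp
  · rw [gaussGram_eq_zero hρ hF hab]
    simp

end Membership

section KernelPolynomial

variable {ι : Type*} [Fintype ι]

/-- The kernel polynomial `∑ b k * ℓ ^ (2 k) * |w| ^ (2 (r - k))` with `ℓ` the linear form
of `z`. -/
noncomputable def kernelPoly (r : ℕ) (b : ℕ → ℝ) (z : ι → ℝ) : MvPolynomial ι ℝ :=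
  ∑ k ∈ Finset.range (r + 1), C (b k) * (linForm z ^ (2 * k) * sqNorm ι ^ (r - k))

theorem gaussE_kernelPoly_sq_mul [Nonempty ι] (r : ℕ) (b : ℕ → ℝ) (z : ι → ℝ) {d : ℕ}
    (β : ι →₀ ℕ) (hβ : β.degree ≤ d) :
    gaussE (kernelPoly r b z ^ 2 * (sqNorm ι ^ (d - β.degree) * monomial (2 • β) 1)) =
      normMoment (Fintype.card ι) (2 * r + d) *
        bilinSum r b (fun n => gaussE (linForm z ^ (2 * n) * monomial (2 • β) 1) /
          normMoment (Fintype.card ι) (n + β.degree)) := by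
  rw [kernelPoly, sq, Finset.sum_mul_sum, Finset.sum_mul, map_sum, bilinSum, Finset.mul_sum]
  refine Finset.sum_congr rfl fun k hk => ?_
  rw [Finset.sum_mul, map_sum, Finset.mul_sum]
  refine Finset.sum_congr rfl fun k' hk' => ?_
  rw [Finset.mem_range] at hk hk'
  have hhom : (linForm z ^ (2 * (k + k')) * monomial (2 • β) (1 : ℝ)).IsHomogeneous
      (2 * (k + k' + β.degree)) := by
    have h1 := (isHomogeneous_linForm z).pow (2 * (k + k'))
    have h2 : (monomial (2 • β) (1 : ℝ)).IsHomogeneous (2 * β.degree) :=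
      isHomogeneous_monomial _ (by simp)
    convert h1.mul h2 using 1
    ring
  have h := gaussE_sqNorm_pow_mul hhom (2 * r + d - (k + k' + β.degree))
  rw [show k + k' + β.degree + (2 * r + d - (k + k' + β.degree)) = 2 * r + d by omega] at h
  have hpos : normMoment (Fintype.card ι) (k + k' + β.degree) ≠ 0 :=
    (normMoment_pos Fintype.card_pos _).ne'
  have hmul : C (b k) * (linForm z ^ (2 * k) * sqNorm ι ^ (r - k)) *
      (C (b k') * (linForm z ^ (2 * k') * sqNorm ι ^ (r - k'))) *
      (sqNorm ι ^ (d - β.degree) * monomial (2 • β) 1) =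
      C (b k * b k') * (sqNorm ι ^ (2 * r + d - (k + k' + β.degree)) *
        (linForm z ^ (2 * (k + k')) * monomial (2 • β) 1)) := by
    rw [show 2 * r + d - (k + k' + β.degree) = (r - k) + (r - k') + (d - β.degree) by omega,
      pow_add, pow_add, mul_add, pow_add, C_mul]
    ring
  rw [hmul, gaussE_C_mul, eq_div_of_mul_eq hpos h]
  ring

theorem kernelPoly_eq_sum [DecidableEq ι] (r : ℕ) (b : ℕ → ℝ) (z : ι → ℝ) :
    kernelPoly r b z =
      ∑ a : ((Finset.range (r + 1)).sigma
          fun k => Finset.piAntidiag (Finset.univ : Finset ι) (2 * k)),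
        C (∏ i, z i ^ a.1.2 i) * (C (b a.1.1 * Nat.multinomial Finset.univ a.1.2) *
          (sqNorm ι ^ (r - a.1.1) * ∏ i, X i ^ a.1.2 i)) := by
  rw [Finset.sum_coe_sort ((Finset.range (r + 1)).sigma
          fun k => Finset.piAntidiag (Finset.univ : Finset ι) (2 * k))
      (fun a => C (∏ i, z i ^ a.2 i) * (C (b a.1 * Nat.multinomial Finset.univ a.2) *
          (sqNorm ι ^ (r - a.1) * ∏ i, X i ^ a.2 i))), Finset.sum_sigma, kernelPoly]
  refine Finset.sum_congr rfl fun k _ => ?_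
  rw [linForm, Finset.sum_pow_eq_sum_piAntidiag, Finset.sum_mul, Finset.mul_sum]
  refine Finset.sum_congr rfl fun α _ => ?_
  simp only [mul_pow, Finset.prod_mul_distrib, C_mul, map_prod, map_pow, map_natCast]
  ring

variable {M : ℕ}

/-- Exponents in the coordinates of the simplex, seen as barycentric exponents. -/
noncomputable def baryExp {N : ℕ} (α : Fin N →₀ ℕ) : Option (Fin N) →₀ ℕ :=
  α.embDomain Function.Embedding.some

theorem baryExp_none {N : ℕ} (α : Fin N →₀ ℕ) : baryExp α none = 0 :=
  Finsupp.embDomain_of_notMem_range _ _ _ (by simp)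

theorem baryExp_some {N : ℕ} (α : Fin N →₀ ℕ) (i : Fin N) : baryExp α (some i) = α i :=
  Finsupp.embDomain_apply_self Function.Embedding.some α i

theorem degree_baryExp {N : ℕ} (α : Fin N →₀ ℕ) : (baryExp α).degree = α.degree := by
  simp [Finsupp.degree_eq_sum, Fintype.sum_option, baryExp_none, baryExp_some]

theorem prod_simplexG_pow_baryExp {N : ℕ} (α : Fin N →₀ ℕ) :
    ∏ i, simplexG N i ^ baryExp α i = monomial α 1 := by
  rw [Fintype.prod_option, baryExp_none, monomial_eq, Finsupp.prod_fintype _ _ (by simp)]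
  simp [baryExp_some, simplexG]

/-- The even form of degree `2 d` which is `|w| ^ (2 d) * f (w ^ 2 / |w| ^ 2)`. -/
noncomputable def evenLift {N : ℕ} (d : ℕ) (f : MvPolynomial (Fin N) ℝ) :
    MvPolynomial (Option (Fin N)) ℝ :=
  ∑ α ∈ f.support, C (coeff α f) *
    (sqNorm (Option (Fin N)) ^ (d - (baryExp α).degree) * monomial (2 • baryExp α) 1)

theorem flipSign_evenLift {N : ℕ} (d : ℕ) (f : MvPolynomial (Fin N) ℝ) (i : Option (Fin N)) :
    flipSign i (evenLift d f) = evenLift d f := by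
  rw [evenLift, map_sum]
  refine Finset.sum_congr rfl fun α _ => ?_
  rw [map_mul, map_mul, map_pow, flipSign_sqNorm, flipSign_monomial, ← algebraMap_eq,
    AlgHom.commutes]
  simp [pow_mul]

theorem eval_evenLift_nonneg {N d : ℕ} (hd : 0 < d) {f : MvPolynomial (Fin N) ℝ}
    (hf : f.totalDegree ≤ d) (hnn : ∀ x ∈ stdSimplexSet N, 0 ≤ eval x f)
    (w : Option (Fin N) → ℝ) : 0 ≤ eval w (evenLift d f) := by
  have hS : eval w (sqNorm (Option (Fin N))) = ∑ i, w i ^ 2 := by simp [sqNorm]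
  have hS0 : 0 ≤ ∑ i, w i ^ 2 := Finset.sum_nonneg fun i _ => sq_nonneg _
  have hmon : ∀ α : Fin N →₀ ℕ, eval w (monomial (2 • baryExp α) (1 : ℝ)) =
      ∏ i, (w (some i) ^ 2) ^ α i := by
    intro α
    rw [eval_monomial, one_mul, Finsupp.prod_fintype _ _ (by simp), Fintype.prod_option]
    simp [baryExp_none, baryExp_some, pow_mul]
  have hdeg : ∀ α ∈ f.support, α.degree ≤ d := fun α hα => by
    have := (le_totalDegree hα).trans hf
    rwa [Finsupp.sum_fintype _ _ (by simp), ← Finsupp.degree_eq_sum] at this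
  rw [evenLift, map_sum]
  simp only [map_mul, eval_C, map_pow, hS, hmon, degree_baryExp]
  rcases hS0.eq_or_lt with h0 | hpos
  · have hw : ∀ i, w i = 0 := by
      intro i
      have := (Finset.sum_eq_zero_iff_of_nonneg fun i _ => sq_nonneg (w i)).1 h0.symm i
        (Finset.mem_univ i)
      exact pow_eq_zero_iff two_ne_zero |>.1 this
    refine Finset.sum_nonneg fun α hα => ?_
    rcases eq_or_ne α 0 with rfl | hα0
    · simp [← h0, zero_pow hd.ne']
    · obtain ⟨i, hi⟩ : ∃ i, α i ≠ 0 := by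
        by_contra! hcon
        exact hα0 (Finsupp.ext hcon)
      rw [Finset.prod_eq_zero (Finset.mem_univ i) (by simp [hw, hi])]
      simp
  · set S := ∑ i, w i ^ 2 with hSdef
    have hx : (fun i => w (some i) ^ 2 / S) ∈ stdSimplexSet N := by
      refine ⟨fun i => div_nonneg (sq_nonneg _) hS0, ?_⟩
      rw [← Finset.sum_div, div_le_one hpos, hSdef, Fintype.sum_option]
      linarith [sq_nonneg (w none)]
    refine (mul_nonneg (pow_nonneg hS0 d) (hnn _ hx)).trans_eq ?_
    rw [eval_eq, Finset.mul_sum]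
    refine Finset.sum_congr rfl fun α hα => ?_
    have hprod : ∏ i ∈ α.support, (w (some i) ^ 2 / S) ^ α i =
        (∏ i, (w (some i) ^ 2) ^ α i) / S ^ α.degree := by
      rw [Finset.prod_subset (Finset.subset_univ _) (fun i _ hi => by
        rw [Finsupp.notMem_support_iff.1 hi, pow_zero])]
      simp only [div_pow]
      rw [Finset.prod_div_distrib, Finset.prod_pow_eq_pow_sum, Finsupp.degree_eq_sum]
    rw [hprod, ← pow_sub_mul_pow S (hdeg α hα)]
    field_simp

theorem exists_inPreSimplex_kernel {d : ℕ} (hd : 0 < d) {f : MvPolynomial (Fin (M + 1)) ℝ}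
    (hf : f.totalDegree ≤ d) (hnn : ∀ x ∈ stdSimplexSet (M + 1), 0 ≤ eval x f)
    (r : ℕ) (b : ℕ → ℝ) :
    ∃ P : MvPolynomial (Fin (M + 1)) ℝ, InPreSimplex (M + 1) r P ∧
      ∀ x z, (∀ i, z i ^ 2 = eval x (simplexG (M + 1) i)) →
        eval x P = ∑ α ∈ f.support, coeff α f *
          bilinSum r b (fun n => gaussE (linForm z ^ (2 * n) * monomial (2 • baryExp α) 1) /
            normMoment (M + 2) (n + (baryExp α).degree)) := by
  classical
  have hdeg : ∀ α ∈ f.support, (baryExp α).degree ≤ d := fun α hα => by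
    have := (le_totalDegree hα).trans hf
    rwa [Finsupp.sum_fintype _ _ (by simp), ← Finsupp.degree_eq_sum, ← degree_baryExp] at this
  obtain ⟨P, hP, he⟩ := exists_inPreSimplex_gaussE_sq (N := M + 1) (r := r)
    (κ := ((Finset.range (r + 1)).sigma
      fun k => Finset.piAntidiag (Finset.univ : Finset (Option (Fin (M + 1)))) (2 * k)))
    (ρ := fun a => C (b a.1.1 * Nat.multinomial Finset.univ a.1.2) *
      (sqNorm _ ^ (r - a.1.1) * ∏ i, X i ^ a.1.2 i))
    (F := evenLift d f) (e := fun a => a.1.2)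
    (fun i a => by
      have hX : (∏ j, X j ^ a.1.2 j : MvPolynomial (Option (Fin (M + 1))) ℝ) =
          monomial (Finsupp.equivFunOnFinite.symm a.1.2) 1 := by
        rw [monomial_eq, Finsupp.prod_fintype _ _ (by simp)]
        simp
      have hC : ∀ c : ℝ, flipSign i (C c : MvPolynomial (Option (Fin (M + 1))) ℝ) = C c :=
        AlgHom.commutes (flipSign i)
      rw [hX, map_mul (flipSign i), hC, map_mul (flipSign i), map_pow (flipSign i), flipSign_sqNorm,
        flipSign_monomial, Finsupp.equivFunOnFinite_symm_apply_apply]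
      ring)
    (flipSign_evenLift d f) (eval_evenLift_nonneg hd hf hnn)
    (fun a => by
      have h := Finset.mem_sigma.1 a.2
      rw [Finset.mem_range, Finset.mem_piAntidiag] at h
      have h1 : ∑ i, a.1.2 i = 2 * a.1.1 := h.2.1
      have h2 := h.1
      change ∑ i, a.1.2 i ≤ 2 * r
      omega)
  have hpos : 0 < normMoment (M + 2) (2 * r + d) := normMoment_pos (by omega) _
  refine ⟨C (normMoment (M + 2) (2 * r + d))⁻¹ * P, hP.C_mul (by positivity), fun x z hz => ?_⟩
  have hcard : Fintype.card (Option (Fin (M + 1))) = M + 2 := by simp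
  rw [map_mul, eval_C, he x z hz, ← kernelPoly_eq_sum, evenLift, Finset.mul_sum, map_sum,
    Finset.mul_sum]
  refine Finset.sum_congr rfl fun α hα => ?_
  rw [mul_left_comm, gaussE_C_mul, gaussE_kernelPoly_sq_mul r b z _ (hdeg α hα), hcard]
  field_simp

end KernelPolynomial

section Coefficients

theorem mem_stdSimplexSet_of_mem_Icc {N : ℕ} {x : Fin N → ℝ}
    (hx : ∀ i, x i ∈ Set.Icc (0 : ℝ) (1 / N)) : x ∈ stdSimplexSet N := by
  refine ⟨fun i => (hx i).1, (Finset.sum_le_sum fun i _ => (hx i).2).trans ?_⟩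
  simpa [div_eq_mul_inv] using mul_inv_le_one

theorem exists_abs_coeff_le (N d : ℕ) (hN : 0 < N) (α : Fin N →₀ ℕ) :
    ∃ L : ℝ, ∀ f : MvPolynomial (Fin N) ℝ, f.totalDegree ≤ d →
      ∀ B, (∀ x ∈ stdSimplexSet N, |eval x f| ≤ B) → |coeff α f| ≤ L * B := by
  classical
  obtain ⟨S, hSsub, hScard⟩ :=
    (Set.Icc_infinite (show (0 : ℝ) < 1 / N by positivity)).exists_subset_card_eq (d + 1)
  let E : restrictTotalDegree (Fin N) ℝ d →ₗ[ℝ] ((Fin N → S) → ℝ) :=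
    LinearMap.pi fun s => (aeval fun i => (s i : ℝ)).toLinearMap ∘ₗ
      (restrictTotalDegree (Fin N) ℝ d).subtype
  have hE : ∀ p s, E p s = eval (fun i => (s i : ℝ)) p.1 := fun p s => by
    simp [E, aeval_eq_eval]
  have hker : LinearMap.ker E = ⊥ := by
    rw [LinearMap.ker_eq_bot']
    intro p hp
    refine Subtype.ext (eq_zero_of_eval_zero_at_prod_finset p.1 (fun _ => S) (fun i => ?_)
      fun x hx => ?_)
    · have := (degreeOf_le_totalDegree p.1 i).trans ((mem_restrictTotalDegree _ _ _).1 p.2)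
      omega
    · have := congrFun hp fun i => ⟨x i, hx i⟩
      rwa [hE] at this
  obtain ⟨g, hg⟩ := E.exists_leftInverse_of_injective hker
  let c : (Fin N → S) → ℝ := fun s => coeff α (g (Pi.single s 1)).1
  refine ⟨∑ s, |c s|, fun f hf B hB => ?_⟩
  let p : restrictTotalDegree (Fin N) ℝ d := ⟨f, (mem_restrictTotalDegree _ _ _).2 hf⟩
  have hp : p = ∑ s, E p s • g (Pi.single s 1) := by
    conv_lhs => rw [← LinearMap.id_apply (R := ℝ) p, ← hg, LinearMap.comp_apply,
      pi_eq_sum_univ' (E p), map_sum]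
    simp
  have hcoeff : coeff α f = ∑ s, E p s * c s := by
    have := congrArg (fun q : restrictTotalDegree (Fin N) ℝ d => coeff α q.1) hp
    simpa [coeff_sum, c] using this
  rw [hcoeff, Finset.sum_mul]
  refine (Finset.abs_sum_le_sum_abs _ _).trans (Finset.sum_le_sum fun s _ => ?_)
  rw [abs_mul, mul_comm, hE]
  exact mul_le_mul_of_nonneg_left
    (hB _ (mem_stdSimplexSet_of_mem_Icc fun i => hSsub (s i).2)) (abs_nonneg _)

end Coefficients

section Convergence

theorem exists_inPreSimplex_sub {M d : ℕ} (hd : 0 < d) :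
    ∃ K : ℝ, 0 < K ∧ ∀ f : MvPolynomial (Fin (M + 1)) ℝ, f.totalDegree ≤ d →
      ∀ r : ℕ, 0 < r → d ≤ 2 * r → ∀ m B : ℝ,
        (∀ x ∈ stdSimplexSet (M + 1), m ≤ eval x f ∧ eval x f ≤ B) →
          InPreSimplex (M + 1) r (f - C (m - K / (r : ℝ) ^ 2 * (B - m))) := by
  classical
  obtain ⟨C₀, -, hker⟩ := exists_isGoodKernel M
  choose L hL using exists_abs_coeff_le (M + 1) d M.succ_pos
  choose Q hQ using fun α : Fin (M + 1) →₀ ℕ => exists_preBounded_kernel_error C₀ (baryExp α)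
  let S := (Finsupp.finite_of_degree_le (σ := Fin (M + 1)) d).toFinset
  refine ⟨∑ α ∈ S, |L α| * |Q α| + 1, by positivity, fun f hf r hr hdr m B hmB => ?_⟩
  obtain ⟨b, hb⟩ := hker r hr
  have hzero : (0 : Fin (M + 1) → ℝ) ∈ stdSimplexSet (M + 1) := by simp [stdSimplexSet]
  have hB : 0 ≤ B - m := sub_nonneg.2 ((hmB 0 hzero).1.trans (hmB 0 hzero).2)
  set f' := f - C m with hf'
  have hdeg : f'.totalDegree ≤ d := (totalDegree_sub_C_le f m).trans hf
  have hev : ∀ x, eval x f' = eval x f - m := fun x => by simp [hf']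
  have hdegα : ∀ α ∈ f'.support, α.degree ≤ d := fun α hα => by
    have := (le_totalDegree hα).trans hdeg
    rwa [Finsupp.sum_fintype _ _ (by simp), ← Finsupp.degree_eq_sum] at this
  obtain ⟨P, hP, hPe⟩ := exists_inPreSimplex_kernel hd hdeg
    (fun x hx => by rw [hev]; linarith [(hmB x hx).1]) r b
  have hQ' : ∀ α : Fin (M + 1) →₀ ℕ, ∃ R : MvPolynomial (Fin (M + 1)) ℝ, α ∈ f'.support →
      PreBounded (M + 1) r (Q α / (r : ℝ) ^ 2) R ∧
        ∀ x z, (∀ i, z i ^ 2 = eval x (simplexG (M + 1) i)) →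
          eval x R = eval x (∏ i, simplexG (M + 1) i ^ baryExp α i) -
            bilinSum r b (fun n => gaussE (linForm z ^ (2 * n) * monomial (2 • baryExp α) 1) /
              normMoment (M + 2) (n + (baryExp α).degree)) := fun α => by
    by_cases hα : α ∈ f'.support
    · obtain ⟨R, hR⟩ := hQ α r b hb (by rw [degree_baryExp]; exact (hdegα α hα).trans hdr)
      exact ⟨R, fun _ => hR⟩
    · exact ⟨0, fun h => absurd h hα⟩
  choose R hR using hQ'
  have hdecomp : f' = P + ∑ α ∈ f'.support, C (coeff α f') * R α := by
    refine funext_set (fun _ => Set.Icc (0 : ℝ) (1 / (M + 1 : ℕ)))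
      (fun _ => Set.Icc_infinite (by positivity)) fun x hx => ?_
    have hx' : x ∈ stdSimplexSet (M + 1) :=
      mem_stdSimplexSet_of_mem_Icc fun i => hx i (Set.mem_univ i)
    have hz : ∀ i, √(eval x (simplexG (M + 1) i)) ^ 2 = eval x (simplexG (M + 1) i) :=
      fun i => Real.sq_sqrt (eval_simplexG_nonneg hx' i)
    rw [map_add, hPe x _ hz, map_sum, ← Finset.sum_add_distrib]
    conv_lhs => rw [f'.as_sum, map_sum]
    refine Finset.sum_congr rfl fun α hα => ?_
    rw [map_mul, eval_C, (hR α hα).2 x _ hz, prod_simplexG_pow_baryExp, ← mul_add,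
      add_sub_cancel, ← eval_C (f := x) (coeff α f'), ← map_mul, C_mul_monomial, mul_one]
    simp
  have hbound : PreBounded (M + 1) r
      ((∑ α ∈ S, |L α| * |Q α| + 1) / (r : ℝ) ^ 2 * (B - m))
      (∑ α ∈ f'.support, C (coeff α f') * R α) := by
    refine (PreBounded.sum fun α hα => (hR α hα).1.C_mul (coeff α f')).mono ?_
    have hterm : ∀ α ∈ f'.support, |coeff α f'| * (Q α / (r : ℝ) ^ 2) ≤
        |L α| * |Q α| * ((B - m) / (r : ℝ) ^ 2) := fun α _ => by
      have h1 : |coeff α f'| ≤ |L α| * (B - m) :=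
        (hL α f' hdeg (B - m) fun x hx => by
          rw [hev, abs_le]; constructor <;> linarith [(hmB x hx).1, (hmB x hx).2]).trans
          (mul_le_mul_of_nonneg_right (le_abs_self _) hB)
      calc |coeff α f'| * (Q α / (r : ℝ) ^ 2)
          ≤ |coeff α f'| * (|Q α| / (r : ℝ) ^ 2) := by gcongr; exact le_abs_self _
        _ ≤ |L α| * (B - m) * (|Q α| / (r : ℝ) ^ 2) := by gcongr
        _ = _ := by ring
    have hsub : f'.support ⊆ S := fun α hα => by simpa [S] using hdegα α hα
    calc _ ≤ ∑ α ∈ f'.support, |L α| * |Q α| * ((B - m) / (r : ℝ) ^ 2) :=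
          Finset.sum_le_sum hterm
      _ ≤ ∑ α ∈ S, |L α| * |Q α| * ((B - m) / (r : ℝ) ^ 2) :=
          Finset.sum_le_sum_of_subset_of_nonneg hsub fun _ _ _ => by positivity
      _ ≤ (∑ α ∈ S, |L α| * |Q α| + 1) * ((B - m) / (r : ℝ) ^ 2) := by
          rw [← Finset.sum_mul]
          gcongr
          linarith
      _ = _ := by ring
  convert hP.add hbound.1 using 1
  rw [add_left_comm, ← hdecomp, hf', map_sub]
  ring

theorem isCompact_stdSimplexSet (N : ℕ) : IsCompact (stdSimplexSet N) := by
  have hset : stdSimplexSet N = (⋂ i, {x | 0 ≤ x i}) ∩ {x | ∑ i, x i ≤ 1} := by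
    ext x
    simp [stdSimplexSet]
  have hclosed : IsClosed (stdSimplexSet N) := by
    rw [hset]
    exact (isClosed_iInter fun i => isClosed_le continuous_const (continuous_apply i)).inter
      (isClosed_le (by fun_prop) continuous_const)
  exact (isCompact_Icc (a := (0 : Fin N → ℝ)) (b := 1)).of_isClosed_subset hclosed fun x hx =>
    ⟨hx.1, fun i => (Finset.single_le_sum (fun j _ => hx.1 j) (Finset.mem_univ i)).trans hx.2⟩

end Convergence

/-- Schmüdgen hierarchy convergence rate on the standard simplex:
for all positive `N, d` there is `C(N,d) > 0` such that for every polynomial `f`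
of degree at most `d` and every `r ≥ 2Nd`,
`f_min − lb(f,T(Δ_N))_r ≤ (C(N,d)/r²)·(f_max − f_min)`. -/
theorem stmt8 (N d : ℕ) (hN : 0 < N) (hd : 0 < d) :
    ∃ C : ℝ, 0 < C ∧
      ∀ f : MvPolynomial (Fin N) ℝ, f.totalDegree ≤ d →
        ∀ r : ℕ, 2 * N * d ≤ r →
          sInf {v : ℝ | ∃ x ∈ stdSimplexSet N, v = eval x f} - lbSimplex N r f ≤
            (C / (r : ℝ) ^ 2) *
              (sSup {v : ℝ | ∃ x ∈ stdSimplexSet N, v = eval x f}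
                - sInf {v : ℝ | ∃ x ∈ stdSimplexSet N, v = eval x f}) := by
  obtain ⟨M, rfl⟩ := Nat.exists_eq_add_of_le' hN
  obtain ⟨K, hK, h⟩ := exists_inPreSimplex_sub (M := M) hd
  refine ⟨K, hK, fun f hf r hr => ?_⟩
  have hdr : d ≤ r := by nlinarith
  have himage : {v : ℝ | ∃ x ∈ stdSimplexSet (M + 1), v = eval x f} =
      (fun x => eval x f) '' stdSimplexSet (M + 1) := by
    ext v
    simp [eq_comm]
  have hcomp : IsCompact {v : ℝ | ∃ x ∈ stdSimplexSet (M + 1), v = eval x f} := by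
    rw [himage]
    exact (isCompact_stdSimplexSet _).image (MvPolynomial.continuous_eval f)
  have hzero : (0 : Fin (M + 1) → ℝ) ∈ stdSimplexSet (M + 1) := by simp [stdSimplexSet]
  have hmem := h f hf r (hd.trans_le hdr) (by omega) _ _ fun x hx =>
    ⟨csInf_le hcomp.bddBelow ⟨x, hx, rfl⟩, le_csSup hcomp.bddAbove ⟨x, hx, rfl⟩⟩
  have hbdd : BddAbove {c : ℝ | InPreSimplex (M + 1) r (f - MvPolynomial.C c)} :=
    ⟨eval 0 f, fun c hc => by simpa using InPreSimplex.eval_nonneg hc hzero⟩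
  have hle := le_csSup hbdd hmem
  rw [lbSimplex]
  linarith
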